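/- arXiv:1011.2594 — 11 statements merged into one kernel-verified Lean document; each statement's English description precedes it below -/
import Mathlib

section
/- For every integer n, every integer l with n ≤ l ≤ n + N_b, and every integer m with n + N_b ≤ m ≤ N + n, one has g_{l,m,n} ≥ 0. -/
theorem statement0_aux (Na Nb : ℕ) (hNa : 1 ≤ Na) (hNb : 1 ≤ Nb)
    (κ : ℤ → ℝ)
    (hper : ∀ n : ℤ, κ (n + (Na + Nb : ℤ)) = κ n)
    (hmono : ∀ m n : ℤ, 1 ≤ m → m < n → n ≤ (Na + Nb : ℤ) → κ m < κ n)
    (n l m : ℤ) (hn1 : 1 ≤ n) (hn2 : n ≤ (Na + Nb : ℤ)) (hl1 : n ≤ l) (hl2 : l ≤ n + (Nb : ℤ))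
    (hm1 : n + (Nb : ℤ) ≤ m) (hm2 : m ≤ (Na + Nb : ℤ) + n) :
    0 ≤ (κ l - κ m) * (κ n - κ (n + (Nb : ℤ))) *
        (κ l + κ m - κ n - κ (n + (Nb : ℤ))) := by
  have hm : ∀ p q : ℤ, 1 ≤ p → p ≤ q → q ≤ (Na + Nb : ℤ) → κ p ≤ κ q := by
    intro p q h1 h2 h3
    rcases h2.lt_or_eq with h | h
    · exact (hmono p q h1 h h3).le
    · rw [h]
  have hs : ∀ p : ℤ, κ p = κ (p - (Na + Nb : ℤ)) := by
    intro p
    have := hper (p - (Na + Nb : ℤ))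
    rwa [sub_add_cancel] at this
  by_cases h : n + (Nb : ℤ) ≤ (Na + Nb : ℤ)
  · have h1 := hm n l hn1 hl1 (by omega)
    have h2 := hm l (n + Nb) (by omega) hl2 h
    by_cases h' : m ≤ (Na + Nb : ℤ)
    · have h3 := hm (n + Nb) m (by omega) hm1 h'
      exact mul_nonneg (mul_nonneg_of_nonpos_of_nonpos (by linarith) (by linarith)) (by linarith)
    · have h3 := hm (m - (Na + Nb : ℤ)) n (by omega) (by omega) hn2
      rw [← hs] at h3
      exact mul_nonneg_of_nonpos_of_nonpos
        (mul_nonpos_of_nonneg_of_nonpos (by linarith) (by linarith)) (by linarith)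
  · have h1 := hm (n + Nb - (Na + Nb : ℤ)) (m - (Na + Nb : ℤ)) (by omega) (by omega) (by omega)
    have h2 := hm (m - (Na + Nb : ℤ)) n (by omega) (by omega) hn2
    rw [← hs] at h2
    rw [← hs, ← hs] at h1
    by_cases h' : l ≤ (Na + Nb : ℤ)
    · have h3 := hm n l hn1 hl1 h'
      exact mul_nonneg (mul_nonneg (by linarith) (by linarith)) (by linarith)
    · have h3 := hm (l - (Na + Nb : ℤ)) (n + Nb - (Na + Nb : ℤ)) (by omega) (by omega) (by omega)
      rw [← hs, ← hs] at h3
      exact mul_nonneg_of_nonpos_of_nonpos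
        (mul_nonpos_of_nonpos_of_nonneg (by linarith) (by linarith)) (by linarith)

/-- Let `N_a, N_b ≥ 1`, `N = N_a + N_b`, `κ_1 < ⋯ < κ_N` real, extended
periodically to all integers (`κ_{n+N} = κ_n`), and
`g_{l,m,n} = (κ_l − κ_m)(κ_n − κ_{n+N_b})(κ_l + κ_m − κ_n − κ_{n+N_b})`.
Then for all integers `n`, `l` with `n ≤ l ≤ n + N_b`, and `m` with
`n + N_b ≤ m ≤ N + n`, we have `g_{l,m,n} ≥ 0`. -/
theorem statement0 (Na Nb : ℕ) (hNa : 1 ≤ Na) (hNb : 1 ≤ Nb)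
    (κ : ℤ → ℝ)
    (hper : ∀ n : ℤ, κ (n + (Na + Nb : ℤ)) = κ n)
    (hmono : ∀ m n : ℤ, 1 ≤ m → m < n → n ≤ (Na + Nb : ℤ) → κ m < κ n)
    (n l m : ℤ) (hl1 : n ≤ l) (hl2 : l ≤ n + (Nb : ℤ))
    (hm1 : n + (Nb : ℤ) ≤ m) (hm2 : m ≤ (Na + Nb : ℤ) + n) :
    0 ≤ (κ l - κ m) * (κ n - κ (n + (Nb : ℤ))) *
        (κ l + κ m - κ n - κ (n + (Nb : ℤ))) := by
  have hP : Function.Periodic κ (Na + Nb : ℤ) := hper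
  obtain ⟨q, hq1, hq2⟩ : ∃ q : ℤ, 1 ≤ n - q * (Na + Nb : ℤ) ∧
      n - q * (Na + Nb : ℤ) ≤ (Na + Nb : ℤ) := by
    have hpos : (0 : ℤ) < (Na + Nb : ℤ) := by omega
    refine ⟨(n - 1) / (Na + Nb : ℤ), ?_, ?_⟩
    · have := Int.ediv_mul_le (n - 1) hpos.ne'
      linarith
    · have := Int.lt_ediv_add_one_mul_self (n - 1) hpos
      linarith
  have hs : ∀ p : ℤ, κ (p - q * (Na + Nb : ℤ)) = κ p := fun p => hP.sub_int_mul_eq q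
  have key := statement0_aux Na Nb hNa hNb κ hper hmono (n - q * (Na + Nb : ℤ))
    (l - q * (Na + Nb : ℤ)) (m - q * (Na + Nb : ℤ)) hq1 hq2 (by linarith) (by linarith)
    (by linarith) (by linarith)
  have e : n - q * (Na + Nb : ℤ) + (Nb : ℤ) = n + Nb - q * (Na + Nb : ℤ) := by ring
  rw [e] at key
  simpa only [hs] using key
end

section
/- For every integer n, every integer l with n ≤ l ≤ n + N_b, and every integer m with n + N_b ≤ m ≤ N + n, one has g_{l,m,n} = 0 if and only if (l ≡ n or l ≡ n + N_b modulo N) and (m ≡ n or m ≡ n + N_b modulo N). -/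
theorem aux_core (N : ℤ) (κ : ℤ → ℝ)
    (hmono : ∀ m n : ℤ, 1 ≤ m → m < n → n ≤ N → κ m < κ n)
    (a b x y : ℤ) (ha : 1 ≤ a) (hab : a < b) (hb : b ≤ N) (hx1 : a ≤ x) (hx2 : x ≤ b)
    (hy1 : 1 ≤ y) (hy2 : y ≤ N) (hy : y ≤ a ∨ b ≤ y) :
    (κ x - κ y) * (κ a - κ b) * (κ x + κ y - κ a - κ b) = 0 ↔
      ((x = a ∨ x = b) ∧ (y = a ∨ y = b)) := by
  have hk := hmono a b ha hab hb
  constructor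
  · intro h
    have hxa : x = a ∨ κ a < κ x := by
      rcases hx1.eq_or_lt with h | h
      · exact Or.inl h.symm
      · exact Or.inr (hmono _ _ ha h (by omega))
    have hxb : x = b ∨ κ x < κ b := by
      rcases hx2.eq_or_lt with h | h
      · exact Or.inl h
      · exact Or.inr (hmono _ _ (by omega) h hb)
    have hyy : y = a ∨ y = b ∨ κ y < κ a ∨ κ b < κ y := by
      rcases hy with h | h
      · rcases h.eq_or_lt with h | h
        · exact Or.inl h
        · exact Or.inr (Or.inr (Or.inl (hmono _ _ hy1 h (by omega))))
      · rcases h.eq_or_lt with h | h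
        · exact Or.inr (Or.inl h.symm)
        · exact Or.inr (Or.inr (Or.inr (hmono _ _ (by omega) h hy2)))
    have h' : κ x = κ y ∨ κ x + κ y = κ a + κ b := by
      rcases mul_eq_zero.1 h with h | h
      · rcases mul_eq_zero.1 h with h | h
        · left; linarith
        · linarith
      · right; linarith
    have e1 : x = a → κ x = κ a := fun h => by rw [h]
    have e2 : x = b → κ x = κ b := fun h => by rw [h]
    have e3 : y = a → κ y = κ a := fun h => by rw [h]
    have e4 : y = b → κ y = κ b := fun h => by rw [h]
    grind
  · rintro ⟨rfl | rfl, rfl | rfl⟩ <;> ring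

theorem aux_per (N : ℤ) (κ : ℤ → ℝ) (hper : ∀ n : ℤ, κ (n + N) = κ n)
    (x y : ℤ) (h : x ≡ y [ZMOD N]) : κ x = κ y := by
  obtain ⟨k, hk⟩ := h.dvd
  have hp : Function.Periodic κ N := hper
  have := hp.int_mul k x
  rw [← this]
  congr 1
  push_cast
  linarith [mul_comm N k]

theorem aux_eq (N x a : ℤ) (h1 : 1 ≤ x) (h2 : x ≤ N) (h3 : 1 ≤ a) (h4 : a ≤ N) :
    x ≡ a [ZMOD N] ↔ x = a := by
  constructor
  · intro h
    have := Int.eq_zero_of_abs_lt_dvd h.dvd (by rw [abs_lt]; constructor <;> omega)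
    omega
  · rintro rfl; rfl

theorem aux_tr (N : ℤ) {x y a b : ℤ} (h : x ≡ y [ZMOD N]) (h' : a ≡ b [ZMOD N]) :
    x ≡ a [ZMOD N] ↔ y ≡ b [ZMOD N] :=
  ⟨fun k => h.symm.trans (k.trans h'), fun k => h.trans (k.trans h'.symm)⟩

/-- core statement transported along congruences -/
theorem aux_core2 (N : ℤ) (κ : ℤ → ℝ) (hper : ∀ n : ℤ, κ (n + N) = κ n)
    (hmono : ∀ m n : ℤ, 1 ≤ m → m < n → n ≤ N → κ m < κ n)
    (a b x y : ℤ) (ha : 1 ≤ a) (hab : a < b) (hb : b ≤ N) (hx1 : a ≤ x) (hx2 : x ≤ b)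
    (hy1 : 1 ≤ y) (hy2 : y ≤ N) (hy : y ≤ a ∨ b ≤ y) (p q l m : ℤ)
    (hp : p ≡ a [ZMOD N]) (hq : q ≡ b [ZMOD N]) (hl : l ≡ x [ZMOD N]) (hm : m ≡ y [ZMOD N]) :
    (κ l - κ m) * (κ p - κ q) * (κ l + κ m - κ p - κ q) = 0 ↔
      ((l ≡ p [ZMOD N] ∨ l ≡ q [ZMOD N]) ∧ (m ≡ p [ZMOD N] ∨ m ≡ q [ZMOD N])) := by
  rw [aux_tr N hl hp, aux_tr N hl hq, aux_tr N hm hp, aux_tr N hm hq,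
    aux_per N κ hper _ _ hp, aux_per N κ hper _ _ hq, aux_per N κ hper _ _ hl,
    aux_per N κ hper _ _ hm, aux_eq, aux_eq, aux_eq, aux_eq]
  · exact aux_core N κ hmono a b x y ha hab hb hx1 hx2 hy1 hy2 hy
  all_goals omega

/-- With `N_a, N_b ≥ 1`, `N = N_a + N_b`, `κ_1 < ⋯ < κ_N` extended
`N`-periodically to all integers, and
`g_{l,m,n} = (κ_l − κ_m)(κ_n − κ_{n+N_b})(κ_l + κ_m − κ_n − κ_{n+N_b})`:
for all integers `n`, `l` with `n ≤ l ≤ n + N_b`, and `m` with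
`n + N_b ≤ m ≤ N + n`, `g_{l,m,n} = 0` if and only if
(`l ≡ n` or `l ≡ n + N_b` mod `N`) and (`m ≡ n` or `m ≡ n + N_b` mod `N`). -/
theorem statement1 (Na Nb : ℕ) (hNa : 1 ≤ Na) (hNb : 1 ≤ Nb)
    (κ : ℤ → ℝ)
    (hper : ∀ n : ℤ, κ (n + (Na + Nb : ℤ)) = κ n)
    (hmono : ∀ m n : ℤ, 1 ≤ m → m < n → n ≤ (Na + Nb : ℤ) → κ m < κ n)
    (n l m : ℤ) (hl1 : n ≤ l) (hl2 : l ≤ n + (Nb : ℤ))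
    (hm1 : n + (Nb : ℤ) ≤ m) (hm2 : m ≤ (Na + Nb : ℤ) + n) :
    (κ l - κ m) * (κ n - κ (n + (Nb : ℤ))) *
        (κ l + κ m - κ n - κ (n + (Nb : ℤ))) = 0 ↔
      ((l ≡ n [ZMOD (Na + Nb : ℤ)] ∨ l ≡ n + (Nb : ℤ) [ZMOD (Na + Nb : ℤ)]) ∧
       (m ≡ n [ZMOD (Na + Nb : ℤ)] ∨ m ≡ n + (Nb : ℤ) [ZMOD (Na + Nb : ℤ)])) := by
  obtain ⟨N, hN⟩ : ∃ N : ℤ, N = (Na + Nb : ℤ) := ⟨_, rfl⟩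
  simp only [← hN] at hm2 ⊢
  simp only [← hN] at hper hmono
  obtain ⟨k, a, hk, ha1, ha2⟩ : ∃ k a : ℤ, n = a + N * k ∧ 1 ≤ a ∧ a ≤ N := by
    refine ⟨(n - 1) / N, (n - 1) % N + 1, ?_, ?_, ?_⟩
    · have := Int.emod_add_mul_ediv (n - 1) N
      linarith
    · have := Int.emod_nonneg (n - 1) (b := N) (by omega)
      omega
    · have := Int.emod_lt_of_pos (n - 1) (b := N) (by omega)
      omega
  have c0 : ∀ x : ℤ, x ≡ x - N * k [ZMOD N] := fun x =>
    (Int.modEq_iff_dvd.2 ⟨-k, by ring⟩)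
  have c1 : ∀ x : ℤ, x ≡ x - N * k - N [ZMOD N] := fun x =>
    (Int.modEq_iff_dvd.2 ⟨-k - 1, by ring⟩)
  generalize N * k = t at *
  by_cases hA : a + Nb ≤ N
  · by_cases hm : m - t ≤ N
    · refine aux_core2 N κ hper hmono (n - t) (n + Nb - t) (l - t) (m - t) ?_ ?_ ?_ ?_ ?_ ?_ ?_ ?_
        _ _ _ _ (c0 _) (c0 _) (c0 _) (c0 _) <;> omega
    · refine aux_core2 N κ hper hmono (n - t) (n + Nb - t) (l - t) (m - t - N)
        ?_ ?_ ?_ ?_ ?_ ?_ ?_ ?_ _ _ _ _ (c0 _) (c0 _) (c0 _) (c1 _) <;> omega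
  · have key : ∀ x : ℤ, l ≡ x [ZMOD N] → 1 ≤ x → x ≤ N → (x ≤ n + Nb - t - N ∨ n - t ≤ x) → _ :=
      fun x hx h1 h2 h3 => aux_core2 N κ hper hmono (n + Nb - t - N) (n - t) (m - t - N) x
        (by omega) (by omega) (by omega) (by omega) (by omega) h1 h2 h3
        (n + Nb) n m l (c1 _) (c0 _) (c1 _) hx
    have key2 : (κ m - κ l) * (κ (n + Nb) - κ n) * (κ m + κ l - κ (n + Nb) - κ n) = 0 ↔
      ((m ≡ n + Nb [ZMOD N] ∨ m ≡ n [ZMOD N]) ∧ (l ≡ n + Nb [ZMOD N] ∨ l ≡ n [ZMOD N])) := by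
      by_cases hl : l - t ≤ N
      · exact key _ (c0 l) (by omega) (by omega) (by omega)
      · exact key _ (c1 l) (by omega) (by omega) (by omega)
    rw [and_comm, or_comm, or_comm (a := l ≡ n [ZMOD N]), ← key2]
    constructor <;> intro h <;> linear_combination h
end

section
/- Let n be an integer and let (x_j) be a sequence in ℝ² tending to infinity along the ray r_n. Then for every integer l with n ≤ l ≤ n + N_b and every integer m with n + N_b ≤ m ≤ N + n, the sequence K_l(x_j) − K_m(x_j) either tends to +∞ or is bounded, and it is bounded if and only if (l ≡ n or l ≡ n + N_b modulo N) and (m ≡ n or m ≡ n + N_b modulo N). -/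
noncomputable section

open Filter

/-- `K_n(x) = κ_n x_1 + κ_n² x_2`. -/
def Kf (κ : ℤ → ℝ) (n : ℤ) (x : ℝ × ℝ) : ℝ := κ n * x.1 + κ n ^ 2 * x.2

/-- `y_n = (κ_{n+N_b}² − κ_n², κ_n − κ_{n+N_b})`. -/
def yv (κ : ℤ → ℝ) (Nb : ℕ) (n : ℤ) : ℝ × ℝ :=
  (κ (n + (Nb : ℤ)) ^ 2 - κ n ^ 2, κ n - κ (n + (Nb : ℤ)))

/-- A sequence `(x_j)` in `ℝ²` tends to infinity along the ray `r_n` if there exist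
reals `α_j → +∞` such that `x_j − α_j y_n` is bounded. -/
def AlongRay (κ : ℤ → ℝ) (Nb : ℕ) (n : ℤ) (x : ℕ → ℝ × ℝ) : Prop :=
  ∃ α : ℕ → ℝ, Tendsto α atTop atTop ∧ ∃ C : ℝ, ∀ j, ‖x j - α j • yv κ Nb n‖ ≤ C

theorem cyc_pos (N : ℤ) (hN : 1 ≤ N) (κ : ℤ → ℝ)
    (hper : ∀ k : ℤ, κ (k + N) = κ k)
    (hmono : ∀ k k' : ℤ, 1 ≤ k → k < k' → k' ≤ N → κ k < κ k')
    (i j k : ℤ) (hij : i < j) (hjk : j < k) (hk : k < i + N) :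
    0 < (κ j - κ i) * (κ k - κ j) * (κ k - κ i) := by
  have hp : Function.Periodic κ N := hper
  have h1 := Int.emod_nonneg (i - 1) (by omega : N ≠ 0)
  have h2 := Int.emod_lt_of_pos (i - 1) (by omega : 0 < N)
  have h3 := Int.emod_add_mul_ediv (i - 1) N
  have key : ∀ z : ℤ, κ (z - N * ((i - 1) / N)) = κ z := by
    intro z
    have := hp.sub_int_mul_eq (x := z) ((i - 1) / N)
    rw [mul_comm]
    simpa using this
  rw [← key i, ← key j, ← key k]
  generalize N * ((i - 1) / N) = T at *
  have hi1 : 1 ≤ i - T := by omega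
  have hi2 : i - T ≤ N := by omega
  have hs : ∀ z : ℤ, κ (z - N) = κ z := fun z => by
    have := hper (z - N); rw [sub_add_cancel] at this; exact this.symm
  by_cases hj : j - T ≤ N
  · have a1 := hmono (i - T) (j - T) hi1 (by omega) hj
    by_cases hk' : k - T ≤ N
    · have a2 := hmono (j - T) (k - T) (by omega) (by omega) hk'
      have e1 := sub_pos.2 a1
      have e2 := sub_pos.2 a2
      have e3 := sub_pos.2 (a1.trans a2)
      positivity
    · rw [← hs (k - T)]
      have a2 := hmono (k - T - N) (i - T) (by omega) (by omega) hi2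
      exact mul_pos_of_neg_of_neg
        (mul_neg_of_pos_of_neg (by linarith) (by linarith)) (by linarith)
  · rw [← hs (k - T), ← hs (j - T)]
    have a1 := hmono (j - T - N) (k - T - N) (by omega) (by omega) (by omega)
    have a2 := hmono (k - T - N) (i - T) (by omega) (by omega) hi2
    exact mul_pos_of_neg_of_neg
        (mul_neg_of_neg_of_pos (by linarith) (by linarith)) (by linarith)

/-- With `N_a, N_b ≥ 1`, `N = N_a + N_b`, `κ_1 < ⋯ < κ_N` extended
`N`-periodically, if `(x_j)` tends to infinity along the ray `r_n`, then for every
integer `l` with `n ≤ l ≤ n + N_b` and every integer `m` with `n + N_b ≤ m ≤ N + n`,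
the sequence `K_l(x_j) − K_m(x_j)` either tends to `+∞` or is bounded, and it is
bounded iff (`l ≡ n` or `l ≡ n + N_b` mod `N`) and (`m ≡ n` or `m ≡ n + N_b` mod `N`). -/
theorem statement3 (Na Nb : ℕ) (hNa : 1 ≤ Na) (hNb : 1 ≤ Nb)
    (κ : ℤ → ℝ)
    (hper : ∀ k : ℤ, κ (k + (Na + Nb : ℤ)) = κ k)
    (hmono : ∀ k k' : ℤ, 1 ≤ k → k < k' → k' ≤ (Na + Nb : ℤ) → κ k < κ k')
    (n : ℤ) (x : ℕ → ℝ × ℝ) (hx : AlongRay κ Nb n x)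
    (l m : ℤ) (hl1 : n ≤ l) (hl2 : l ≤ n + (Nb : ℤ))
    (hm1 : n + (Nb : ℤ) ≤ m) (hm2 : m ≤ (Na + Nb : ℤ) + n) :
    (Tendsto (fun j => Kf κ l (x j) - Kf κ m (x j)) atTop atTop ∨
      ∃ C : ℝ, ∀ j, |Kf κ l (x j) - Kf κ m (x j)| ≤ C) ∧
    ((∃ C : ℝ, ∀ j, |Kf κ l (x j) - Kf κ m (x j)| ≤ C) ↔
      ((l ≡ n [ZMOD (Na + Nb : ℤ)] ∨ l ≡ n + (Nb : ℤ) [ZMOD (Na + Nb : ℤ)]) ∧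
       (m ≡ n [ZMOD (Na + Nb : ℤ)] ∨ m ≡ n + (Nb : ℤ) [ZMOD (Na + Nb : ℤ)]))) := by
  have hN : (1 : ℤ) ≤ (Na + Nb : ℤ) := by omega
  have cyc := cyc_pos (Na + Nb : ℤ) hN κ hper hmono
  obtain ⟨α, hα, C, hC⟩ := hx
  have hcong : ((l ≡ n [ZMOD (Na + Nb : ℤ)] ∨ l ≡ n + (Nb : ℤ) [ZMOD (Na + Nb : ℤ)]) ∧
       (m ≡ n [ZMOD (Na + Nb : ℤ)] ∨ m ≡ n + (Nb : ℤ) [ZMOD (Na + Nb : ℤ)])) ↔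
      ((l = n ∨ l = n + Nb) ∧ (m = n + Nb ∨ m = n + (Na + Nb : ℤ))) := by
    have small : ∀ z : ℤ, (Na + Nb : ℤ) ∣ z → |z| < (Na + Nb : ℤ) → z = 0 :=
      fun z h1 h2 => Int.eq_zero_of_abs_lt_dvd h1 h2
    constructor
    · rintro ⟨h1, h2⟩
      constructor
      · rcases h1 with h | h
        · have := small _ h.symm.dvd (by rw [abs_lt]; omega)
          omega
        · have := small _ h.symm.dvd (by rw [abs_lt]; omega)
          omega
      · rcases h2 with h | h
        · have h' : (Na + Nb : ℤ) ∣ m - n - (Na + Nb : ℤ) := dvd_sub_self_right.2 h.symm.dvd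
          have := small _ h' (by rw [abs_lt]; omega)
          omega
        · have := small _ h.symm.dvd (by rw [abs_lt]; omega)
          omega
    · rintro ⟨h1, h2⟩
      refine ⟨?_, ?_⟩
      · rcases h1 with h | h
        · left; rw [h]
        · right; rw [h]
      · rcases h2 with h | h
        · right; rw [h]
        · left; rw [h]; simp [Int.ModEq]
  rw [hcong]
  set a := κ n with ha
  set b := κ (n + (Nb : ℤ)) with hb
  set P := (κ l - a) * (b - κ l) * (b - a) with hP
  set Q := (b - a) * (κ m - b) * (κ m - a) with hQ
  have P0 : (l = n ∨ l = n + Nb) → P = 0 := by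
    rintro (h | h)
    · rw [hP, h, ← ha]; ring
    · rw [hP, h, ← hb]; ring
  have P1 : ¬ (l = n ∨ l = n + Nb) → 0 < P := fun h =>
    cyc n l (n + Nb) (by omega) (by omega) (by omega)
  have Q0 : (m = n + Nb ∨ m = n + (Na + Nb : ℤ)) → Q = 0 := by
    rintro (h | h)
    · rw [hQ, h, ← hb]; ring
    · rw [hQ, h, hper, ← ha]; ring
  have Q1 : ¬ (m = n + Nb ∨ m = n + (Na + Nb : ℤ)) → 0 < Q := fun h =>
    cyc n (n + Nb) m (by omega) (by omega) (by omega)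
  have hbd : ∀ j, |Kf κ l (x j) - Kf κ m (x j) - α j * (P + Q)| ≤
      (|κ l - κ m| + |κ l ^ 2 - κ m ^ 2|) * C := by
    intro j
    have e : Kf κ l (x j) - Kf κ m (x j) - α j * (P + Q) =
        (κ l - κ m) * (x j - α j • yv κ Nb n).1 +
        (κ l ^ 2 - κ m ^ 2) * (x j - α j • yv κ Nb n).2 := by
      simp only [Kf, yv, hP, hQ, Prod.fst_sub, Prod.snd_sub, Prod.smul_fst, Prod.smul_snd,
        smul_eq_mul, ← ha, ← hb]
      ring
    have n1 : |(x j - α j • yv κ Nb n).1| ≤ C := (norm_fst_le _).trans (hC j)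
    have n2 : |(x j - α j • yv κ Nb n).2| ≤ C := (norm_snd_le _).trans (hC j)
    rw [e, add_mul]
    refine (abs_add_le _ _).trans ?_
    rw [abs_mul, abs_mul]
    gcongr
  generalize (|κ l - κ m| + |κ l ^ 2 - κ m ^ 2|) * C = D at hbd
  by_cases hc : (l = n ∨ l = n + Nb) ∧ (m = n + Nb ∨ m = n + (Na + Nb : ℤ))
  · have hB : ∃ C : ℝ, ∀ j, |Kf κ l (x j) - Kf κ m (x j)| ≤ C := by
      refine ⟨D, fun j => ?_⟩
      have := hbd j
      rwa [P0 hc.1, Q0 hc.2, add_zero, mul_zero, sub_zero] at this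
    exact ⟨Or.inr hB, fun _ => hc, fun _ => hB⟩
  · have hpos : 0 < P + Q := by
      by_cases h1 : (l = n ∨ l = n + Nb)
      · have := Q1 (fun h2 => hc ⟨h1, h2⟩)
        rw [P0 h1]; linarith
      · have := P1 h1
        by_cases h2 : (m = n + Nb ∨ m = n + (Na + Nb : ℤ))
        · rw [Q0 h2]; linarith
        · linarith [Q1 h2]
    have ht : Tendsto (fun j => Kf κ l (x j) - Kf κ m (x j)) atTop atTop := by
      have h1 : Tendsto (fun j => α j * (P + Q) + -D) atTop atTop :=
        tendsto_atTop_add_const_right _ _ (hα.atTop_mul_const hpos)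
      refine tendsto_atTop_mono (fun j => ?_) h1
      have := (abs_le.1 (hbd j)).1
      linarith
    refine ⟨Or.inl ht, fun ⟨E, hE⟩ => ?_, fun h => absurd h hc⟩
    obtain ⟨j, hj⟩ := (ht.eventually_gt_atTop E).exists
    have := (abs_le.1 (hE j)).2
    exact absurd hj (not_lt.2 this)

end
end

section
/- Let n be an integer and let (x_j) be a sequence in ℝ² tending to infinity along the ray r_n. Then exp(−Σ_{l=n}^{n+N_b−1} K_l(x_j)) · τ(x_j) − (z_n + z_{n+1} exp(K_{n+N_b}(x_j) − K_n(x_j))) converges to 0 as j → ∞. -/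
noncomputable section

open Filter Matrix

/-- A sequence `(x_j)` in `ℝ²` tends to infinity in the sector `σ_n` if there exist
reals `α_j → +∞` and `β_j → +∞` such that `x_j − α_j y_{n−1} − β_j y_n` is bounded. -/
def InSector (κ : ℤ → ℝ) (Nb : ℕ) (n : ℤ) (x : ℕ → ℝ × ℝ) : Prop :=
  ∃ α β : ℕ → ℝ, Tendsto α atTop atTop ∧ Tendsto β atTop atTop ∧
    ∃ C : ℝ, ∀ j, ‖x j - α j • yv κ Nb (n - 1) - β j • yv κ Nb n‖ ≤ C

/-- Reduction of an integer index modulo `N` to `{1, …, N}`, realized as an element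
of `Fin N` (so the integer `n` corresponds to the row of index `n` reduced mod `N`). -/
def idx (N : ℕ) (hN : 0 < N) (n : ℤ) : Fin N :=
  ⟨((n - 1) % (N : ℤ)).toNat, by
    have h1 : 0 ≤ (n - 1) % (N : ℤ) := Int.emod_nonneg _ (by exact_mod_cast hN.ne')
    have h2 : (n - 1) % (N : ℤ) < (N : ℤ) := Int.emod_lt_of_pos _ (by exact_mod_cast hN)
    omega⟩

/-- The τ-function `τ(x) = det (V e^{K(x)} Д)`, where `V` is the `N_b × N` incomplete
Vandermonde matrix `V_{i,n} = κ_n^{i−1}` and `e^{K(x)} = diag(e^{K_1(x)}, …, e^{K_N(x)})`. -/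
def tauf (Na Nb : ℕ) (κ : ℤ → ℝ) (D : Matrix (Fin (Na + Nb)) (Fin Nb) ℝ)
    (x : ℝ × ℝ) : ℝ :=
  (Matrix.of (fun (i : Fin Nb) (n : Fin (Na + Nb)) => κ ((n : ℤ) + 1) ^ (i : ℕ)) *
    Matrix.diagonal (fun n : Fin (Na + Nb) => Real.exp (Kf κ ((n : ℤ) + 1) x)) * D).det

/-- The coefficient `f_{n_1,…,n_{N_b}} = ∏_{i<j} (κ_{n_j} − κ_{n_i}) · Д(n_1,…,n_{N_b})`,
where `Д(n_1,…,n_{N_b})` is the determinant of the `N_b × N_b` matrix whose `i`-th row is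
the row of `Д` with index `n_i` reduced mod `N` to `{1,…,N}`. -/
def fcoef (Na Nb : ℕ) (hN : 0 < Na + Nb) (κ : ℤ → ℝ)
    (D : Matrix (Fin (Na + Nb)) (Fin Nb) ℝ) (s : Fin Nb → ℤ) : ℝ :=
  (∏ p ∈ Finset.univ.filter (fun p : Fin Nb × Fin Nb => p.1 < p.2),
      (κ (s p.2) - κ (s p.1))) *
    (Matrix.of (fun i l => D (idx (Na + Nb) hN (s i)) l)).det

/-- `z_n = f_{n, n+1, …, n+N_b−1}`. -/
def zc (Na Nb : ℕ) (hN : 0 < Na + Nb) (κ : ℤ → ℝ)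
    (D : Matrix (Fin (Na + Nb)) (Fin Nb) ℝ) (n : ℤ) : ℝ :=
  fcoef Na Nb hN κ D (fun i => n + (i : ℤ))


lemma aux_det (N b : ℕ) (V : Fin b → Fin N → ℝ) (D : Fin N → Fin b → ℝ) (w : Fin N → ℝ) :
    (Matrix.of (fun i l => ∑ m, V i m * w m * D m l)).det =
      ∑ s : Fin b → Fin N, (∏ i, w (s i)) *
        ((∏ i, D (s i) i) * (Matrix.of (fun l i => V i (s l))).det) := by
  rw [← Matrix.det_transpose]
  have h1 : (Matrix.of (fun i l => ∑ m, V i m * w m * D m l))ᵀ =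
      (fun l => ∑ m, (w m * D m l) • (fun i => V i m)) := by
    ext l i
    simp [Matrix.transpose_apply, Finset.sum_apply]
    exact Finset.sum_congr rfl fun m _ => by ring
  rw [h1]
  have h2 := (Matrix.detRowAlternating (R := ℝ) (n := Fin b)).toMultilinearMap.map_sum
    (fun l (m : Fin N) => (w m * D m l) • (fun i => V i m))
  refine h2.trans ?_
  refine Finset.sum_congr rfl fun s _ => ?_
  rw [MultilinearMap.map_smul_univ]
  rw [Finset.prod_mul_distrib, smul_eq_mul, mul_assoc]
  rfl

lemma aux_sub (N b : ℕ) (V : Fin b → Fin N → ℝ) (D : Fin N → Fin b → ℝ) (s0 : Fin b → Fin N)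
    (hs : Function.Injective s0) :
    ∑ s : Fin b → Fin N, (∏ i, (if s i ∈ Finset.univ.image s0 then (1:ℝ) else 0)) *
        ((∏ i, D (s i) i) * (Matrix.of (fun l i => V i (s l))).det) =
    (Matrix.of (fun l i => V i (s0 l))).det * (Matrix.of (fun i l => D (s0 i) l)).det := by
  rw [← aux_det N b V D (fun m => if m ∈ Finset.univ.image s0 then (1:ℝ) else 0)]
  rw [← Matrix.det_transpose (Matrix.of (fun l i => V i (s0 l))), ← Matrix.det_mul]
  congr 1
  ext i l
  simp only [Matrix.of_apply, Matrix.mul_apply, Matrix.transpose_apply]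
  have : ∀ m, V i m * (if m ∈ Finset.univ.image s0 then (1:ℝ) else 0) * D m l =
      if m ∈ Finset.univ.image s0 then V i m * D m l else 0 := by
    intro m; split_ifs <;> simp
  simp_rw [this]
  rw [Finset.sum_ite_mem, Finset.univ_inter, Finset.sum_image (fun a _ b _ h => hs h)]

lemma aux_vdm (b : ℕ) (v : Fin b → ℝ) :
    ∏ p ∈ Finset.univ.filter (fun p : Fin b × Fin b => p.1 < p.2), (v p.2 - v p.1) =
      (Matrix.of (fun l (i : Fin b) => v l ^ (i : ℕ))).det := by
  have : (Matrix.of (fun l (i : Fin b) => v l ^ (i : ℕ))) = Matrix.vandermonde v := by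
    ext i j; simp [Matrix.vandermonde_apply]
  rw [this, Matrix.det_vandermonde, Finset.prod_filter, Fintype.prod_prod_type]
  refine Finset.prod_congr rfl fun i _ => ?_
  rw [← Finset.prod_filter]
  refine Finset.prod_congr ?_ fun _ _ => rfl
  ext j; simp

lemma aux_per_s6 (κ : ℤ → ℝ) (N : ℤ) (hper : ∀ k : ℤ, κ (k + N) = κ k) (k t : ℤ) :
    κ (k + t * N) = κ k := by
  have : Function.Periodic κ N := hper
  simpa using this.int_mul t k

lemma aux_idx (N : ℕ) (hN : 0 < N) (κ : ℤ → ℝ) (hper : ∀ k : ℤ, κ (k + N) = κ k) (k : ℤ) :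
    κ (((idx N hN k : Fin N) : ℤ) + 1) = κ k := by
  have h1 : 0 ≤ (k - 1) % (N : ℤ) := Int.emod_nonneg _ (by exact_mod_cast hN.ne')
  have h2 := Int.emod_add_mul_ediv (k - 1) N
  simp only [idx, Int.toNat_of_nonneg h1]
  rw [← aux_per_s6 κ N hper _ ((k - 1) / N)]
  congr 1
  linarith

lemma aux_bij (N : ℕ) (hN : 0 < N) (n : ℤ) :
    Function.Bijective (fun m : Fin N => idx N hN (n + (m : ℤ))) := by
  rw [← Finite.injective_iff_bijective]
  intro a b hab
  have h1 : 0 ≤ (n + a - 1) % (N : ℤ) := Int.emod_nonneg _ (by exact_mod_cast hN.ne')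
  have h2 : 0 ≤ (n + b - 1) % (N : ℤ) := Int.emod_nonneg _ (by exact_mod_cast hN.ne')
  simp only [idx, Fin.mk.injEq] at hab
  have h3 : (n + a - 1) % (N : ℤ) = (n + b - 1) % (N : ℤ) := by omega
  have h4 := Int.emod_emod_of_dvd
  have h5 : (N : ℤ) ∣ (n + b - 1) - (n + a - 1) := Int.ModEq.dvd h3
  have h6 : (n + b - 1) - (n + a - 1) = (b : ℤ) - a := by ring
  rw [h6] at h5
  have h7 : (b : ℤ) - a = 0 := by
    apply Int.eq_zero_of_abs_lt_dvd h5
    rw [abs_lt]; constructor <;> omega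
  exact Fin.ext (by omega)

lemma aux_cyc (N : ℕ) (hN : 0 < N) (κ : ℤ → ℝ) (hper : ∀ k : ℤ, κ (k + N) = κ k)
    (hmono : ∀ k k' : ℤ, 1 ≤ k → k < k' → k' ≤ (N : ℤ) → κ k < κ k') (n p q : ℤ)
    (hp : 0 < p) (hpq : p < q) (hq : q < N) :
    (κ n < κ (n+p) ∧ κ (n+p) < κ (n+q)) ∨ (κ (n+p) < κ (n+q) ∧ κ (n+q) < κ n) ∨
      (κ (n+q) < κ n ∧ κ n < κ (n+p)) := by
  have h1 : 0 ≤ (n - 1) % (N : ℤ) := Int.emod_nonneg _ (by exact_mod_cast hN.ne')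
  have h2 := Int.emod_add_mul_ediv (n - 1) N
  have h3 : (n - 1) % (N : ℤ) < N := Int.emod_lt_of_pos _ (by exact_mod_cast hN)
  obtain ⟨r, hr⟩ : ∃ r, r = (n - 1) % (N : ℤ) + 1 := ⟨_, rfl⟩
  obtain ⟨t, ht⟩ : ∃ t, t = (n - 1) / (N : ℤ) := ⟨_, rfl⟩
  have hn : n = r + t * N := by rw [hr, ht]; linarith
  have e : ∀ k, κ (n + k) = κ (r + k) := by
    intro k
    rw [hn, show r + t * N + k = (r + k) + t * N by ring, aux_per_s6 κ N hper]
  have e' : ∀ k, κ (n + k) = κ (r + k - N) := by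
    intro k
    rw [e, ← hper (r + k - N)]; congr 1; ring
  have e0 : κ n = κ r := by simpa using e 0
  by_cases c1 : r + p ≤ N
  · by_cases c2 : r + q ≤ N
    · left
      rw [e0, e, e]
      exact ⟨hmono _ _ (by omega) (by omega) (by omega), hmono _ _ (by omega) (by omega) (by omega)⟩
    · right; right
      rw [e0, e p, e' q]
      exact ⟨hmono _ _ (by omega) (by omega) (by omega), hmono _ _ (by omega) (by omega) (by omega)⟩
  · right; left
    rw [e0, e' p, e' q]
    exact ⟨hmono _ _ (by omega) (by omega) (by omega), hmono _ _ (by omega) (by omega) (by omega)⟩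

lemma aux_sign (a c b : ℝ) (h : (a < c ∧ c < b) ∨ (c < b ∧ b < a) ∨ (b < a ∧ a < c)) :
    0 < (b - a) * ((c - a) * (b - c)) := by
  rcases h with ⟨h1, h2⟩ | ⟨h1, h2⟩ | ⟨h1, h2⟩
  · exact mul_pos (by linarith) (mul_pos (by linarith) (by linarith))
  · exact mul_pos_of_neg_of_neg (by linarith) (mul_neg_of_neg_of_pos (by linarith) (by linarith))
  · exact mul_pos_of_neg_of_neg (by linarith) (mul_neg_of_pos_of_neg (by linarith) (by linarith))

lemma aux_q (κ : ℤ → ℝ) (Nb : ℕ) (n k : ℤ) :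
    Kf κ k (yv κ Nb n) - Kf κ n (yv κ Nb n) =
      (κ (n + Nb) - κ n) * ((κ k - κ n) * (κ (n + Nb) - κ k)) := by
  simp only [Kf, yv]; ring

/-- combinatorial core -/
lemma aux_comb (N b : ℕ) (hb : 0 < b) (hbN : b < N) (q : Fin N → ℝ)
    (h0 : ∀ m : Fin N, (m : ℕ) = 0 ∨ (m : ℕ) = b → q m = 0)
    (hpos : ∀ m : Fin N, 0 < (m : ℕ) → (m : ℕ) < b → 0 < q m)
    (hneg : ∀ m : Fin N, b < (m : ℕ) → q m < 0)
    (T : Finset (Fin N)) (hT : T.card = b)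
    (hT0 : T ≠ Finset.univ.filter (fun m : Fin N => (m : ℕ) < b))
    (hT1 : T ≠ Finset.univ.filter (fun m : Fin N => 0 < (m : ℕ) ∧ (m : ℕ) ≤ b)) :
    ∑ m ∈ T, q m < ∑ m ∈ Finset.univ.filter (fun m : Fin N => (m : ℕ) < b), q m := by
  have e1 : ∑ m ∈ Finset.univ.filter (fun m : Fin N => (m : ℕ) < b), q m = ∑ m, max (q m) 0 := by
    rw [Finset.sum_filter]
    refine Finset.sum_congr rfl fun m _ => ?_
    split_ifs with h
    · rcases Nat.eq_zero_or_pos (m : ℕ) with h' | h'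
      · simp [h0 m (Or.inl h')]
      · exact (max_eq_left (hpos m h' h).le).symm
    · rcases (not_lt.mp h).eq_or_lt with h' | h'
      · simp [h0 m (Or.inr h'.symm)]
      · exact (max_eq_right (hneg m h').le).symm
  have e2 : ∑ m ∈ T, q m = ∑ m, if m ∈ T then q m else 0 := by
    rw [Finset.sum_ite_mem, Finset.univ_inter]
  rw [e1, e2]
  have hle : ∀ m, (if m ∈ T then q m else 0) ≤ max (q m) 0 := by
    intro m; split_ifs <;> simp
  refine (Finset.sum_le_sum fun m _ => hle m).lt_of_ne fun heq => ?_
  have hall := (Finset.sum_eq_sum_iff_of_le (fun m _ => hle m)).mp heq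
  have hA : ∀ m ∈ T, (m : ℕ) ≤ b := by
    intro m hm
    by_contra hc
    have := hall m (Finset.mem_univ _)
    have h2 := hneg m (by omega)
    rw [if_pos hm, max_eq_right h2.le] at this
    linarith
  have hB : ∀ m : Fin N, 0 < (m : ℕ) → (m : ℕ) < b → m ∈ T := by
    intro m h1 h2
    by_contra hc
    have := hall m (Finset.mem_univ _)
    have h3 := hpos m h1 h2
    rw [if_neg hc, max_eq_left h3.le] at this
    linarith
  have c0 : (Finset.univ.filter (fun m : Fin N => (m : ℕ) < b)).card = b := by
    rw [Fin.card_filter_val_lt]; omega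
  let z : Fin N := ⟨0, by omega⟩
  let B : Fin N := ⟨b, hbN⟩
  have hzS : z ∈ Finset.univ.filter (fun m : Fin N => (m : ℕ) < b) := by simp [z, hb]
  have i1 : Finset.univ.filter (fun m : Fin N => 0 < (m : ℕ) ∧ (m : ℕ) ≤ b) =
      insert B ((Finset.univ.filter (fun m : Fin N => (m : ℕ) < b)).erase z) := by
    ext m
    simp [z, B, Fin.ext_iff]
    omega
  have c1 : (Finset.univ.filter (fun m : Fin N => 0 < (m : ℕ) ∧ (m : ℕ) ≤ b)).card = b := by
    rw [i1, Finset.card_insert_of_notMem (by simp [B]), Finset.card_erase_of_mem hzS, c0]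
    omega
  by_cases hBT : B ∈ T
  · apply hT1
    symm
    apply Finset.eq_of_subset_of_card_le
    · intro m hm
      simp at hm
      rcases hm.2.eq_or_lt with h | h
      · rwa [show m = B from Fin.ext h]
      · exact hB m hm.1 h
    · rw [c1, hT]
  · apply hT0
    apply Finset.eq_of_subset_of_card_le
    · intro m hm
      have := hA m hm
      have h2 : (m : ℕ) ≠ b := fun h => hBT (by rwa [show m = B from Fin.ext h] at hm)
      simp; omega
    · rw [c0, hT]

lemma aux_lim (a b : ℝ) (y : ℝ × ℝ) (x : ℕ → ℝ × ℝ) (α : ℕ → ℝ) (hα : Tendsto α atTop atTop)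
    (C : ℝ) (hC : ∀ j, ‖x j - α j • y‖ ≤ C) (hneg : a * y.1 + b * y.2 < 0) :
    Tendsto (fun j => Real.exp (a * (x j).1 + b * (x j).2)) atTop (nhds 0) := by
  apply Real.tendsto_exp_atBot.comp
  have h1 : Tendsto (fun j => α j * (a * y.1 + b * y.2) + (|a| * C + |b| * C)) atTop atBot :=
    tendsto_atBot_add_const_right _ _ (hα.atTop_mul_const_of_neg hneg)
  refine tendsto_atBot_mono (fun j => ?_) h1
  have h2 : |(x j).1 - α j * y.1| ≤ C := by
    have := (norm_fst_le (x j - α j • y)).trans (hC j)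
    simpa using this
  have h3 : |(x j).2 - α j * y.2| ≤ C := by
    have := (norm_snd_le (x j - α j • y)).trans (hC j)
    simpa using this
  have h4 : a * ((x j).1 - α j * y.1) ≤ |a| * C :=
    (le_abs_self _).trans (by rw [abs_mul]; exact mul_le_mul_of_nonneg_left h2 (abs_nonneg _))
  have h5 : b * ((x j).2 - α j * y.2) ≤ |b| * C :=
    (le_abs_self _).trans (by rw [abs_mul]; exact mul_le_mul_of_nonneg_left h3 (abs_nonneg _))
  linarith

lemma aux_tau (Na Nb : ℕ) (hN : 0 < Na + Nb) (κ : ℤ → ℝ)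
    (hper : ∀ k : ℤ, κ (k + (Na + Nb : ℕ)) = κ k)
    (D : Matrix (Fin (Na + Nb)) (Fin Nb) ℝ) (n : ℤ) (x : ℝ × ℝ) :
    tauf Na Nb κ D x = (Matrix.of (fun i l : Fin Nb => ∑ m : Fin (Na + Nb),
      κ (n + (m : ℤ)) ^ (i : ℕ) * Real.exp (Kf κ (n + (m : ℤ)) x) *
        D (idx (Na + Nb) hN (n + (m : ℤ))) l)).det := by
  unfold tauf
  congr 1
  ext i l
  rw [Matrix.mul_apply]
  simp only [Matrix.mul_diagonal, Matrix.of_apply]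
  rw [← (Equiv.ofBijective _ (aux_bij (Na + Nb) hN n)).sum_comp]
  refine Finset.sum_congr rfl fun m _ => ?_
  simp only [Equiv.ofBijective_apply, Kf]
  rw [aux_idx (Na + Nb) hN κ hper]

lemma aux_icc (b : ℕ) (n : ℤ) (f : ℤ → ℝ) :
    ∑ l ∈ Finset.Icc n (n + (b : ℤ) - 1), f l = ∑ i : Fin b, f (n + (i : ℤ)) := by
  symm
  refine Finset.sum_bij (fun i _ => n + ((i : ℕ) : ℤ)) ?_ ?_ ?_ ?_
  · intro i _; simp
  · intro i _ j _ h; exact Fin.ext (by simpa using h)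
  · intro l hl
    simp at hl
    exact ⟨⟨(l - n).toNat, by omega⟩, Finset.mem_univ _, by simp; omega⟩
  · intro i _; rfl

/-- if `(x_j)` tends to infinity along the ray `r_n`, then
`exp(−Σ_{l=n}^{n+N_b−1} K_l(x_j)) · τ(x_j) − (z_n + z_{n+1} e^{K_{n+N_b}(x_j) − K_n(x_j)}) → 0`. -/
theorem statement6 (Na Nb : ℕ) (hNa : 0 < Na) (hNb : 0 < Nb)
    (κ : ℤ → ℝ)
    (hper : ∀ k : ℤ, κ (k + (Na + Nb : ℤ)) = κ k)
    (hmono : ∀ k k' : ℤ, 1 ≤ k → k < k' → k' ≤ (Na + Nb : ℤ) → κ k < κ k')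
    (D : Matrix (Fin (Na + Nb)) (Fin Nb) ℝ)
    (n : ℤ) (x : ℕ → ℝ × ℝ) (hx : AlongRay κ Nb n x) :
    Tendsto
      (fun j =>
        Real.exp (-(∑ l ∈ Finset.Icc n (n + (Nb : ℤ) - 1), Kf κ l (x j))) *
            tauf Na Nb κ D (x j) -
          (zc Na Nb (Nat.add_pos_left hNa Nb) κ D n +
            zc Na Nb (Nat.add_pos_left hNa Nb) κ D (n + 1) *
              Real.exp (Kf κ (n + (Nb : ℤ)) (x j) - Kf κ n (x j))))
      atTop (nhds 0) := by
  obtain ⟨α, hα, C, hC⟩ := hx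
  have hN : 0 < Na + Nb := Nat.add_pos_left hNa Nb
  have hper' : ∀ k : ℤ, κ (k + (Na + Nb : ℕ)) = κ k := by
    intro k; rw [← hper k]; push_cast; rfl
  have hmono' : ∀ k k' : ℤ, 1 ≤ k → k < k' → k' ≤ ((Na + Nb : ℕ) : ℤ) → κ k < κ k' := by
    intro k k' h1 h2 h3; exact hmono k k' h1 h2 (by push_cast at h3; exact h3)
  let V : Fin Nb → Fin (Na + Nb) → ℝ := fun i m => κ (n + (m : ℤ)) ^ (i : ℕ)
  let D' : Fin (Na + Nb) → Fin Nb → ℝ := fun m l => D (idx (Na + Nb) hN (n + (m : ℤ))) l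
  let c : (Fin Nb → Fin (Na + Nb)) → ℝ := fun s =>
    (∏ i, D' (s i) i) * (Matrix.of (fun l i => V i (s l))).det
  let s0 : Fin Nb → Fin (Na + Nb) := fun i => ⟨i, by omega⟩
  let s1 : Fin Nb → Fin (Na + Nb) := fun i => ⟨i + 1, by omega⟩
  have hs0 : Function.Injective s0 := fun i j h => Fin.ext (by simpa [s0] using h)
  have hs1 : Function.Injective s1 := fun i j h => Fin.ext (by simpa [s1] using h)
  have im0 : Finset.univ.image s0 = Finset.univ.filter (fun m : Fin (Na + Nb) => (m : ℕ) < Nb) := by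
    ext m
    simp only [Finset.mem_image, Finset.mem_univ, true_and, Finset.mem_filter]
    constructor
    · rintro ⟨i, rfl⟩; exact i.2
    · intro h; exact ⟨⟨m, h⟩, rfl⟩
  have im1 : Finset.univ.image s1 =
      Finset.univ.filter (fun m : Fin (Na + Nb) => 0 < (m : ℕ) ∧ (m : ℕ) ≤ Nb) := by
    ext m
    simp only [Finset.mem_image, Finset.mem_univ, true_and, Finset.mem_filter]
    constructor
    · rintro ⟨i, rfl⟩; exact ⟨Nat.succ_pos _, i.2⟩
    · intro h; exact ⟨⟨m - 1, by omega⟩, Fin.ext (by simp [s1]; omega)⟩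
  have hz0 : zc Na Nb hN κ D n = ∑ s : Fin Nb → Fin (Na + Nb),
      (∏ i, (if s i ∈ Finset.univ.image s0 then (1:ℝ) else 0)) * c s := by
    rw [aux_sub (Na + Nb) Nb V D' s0 hs0, zc, fcoef, aux_vdm Nb (fun i => κ (n + (i : ℤ)))]
  have hz1 : zc Na Nb hN κ D (n + 1) = ∑ s : Fin Nb → Fin (Na + Nb),
      (∏ i, (if s i ∈ Finset.univ.image s1 then (1:ℝ) else 0)) * c s := by
    rw [aux_sub (Na + Nb) Nb V D' s1 hs1, zc, fcoef, aux_vdm Nb (fun i => κ (n + 1 + (i : ℤ)))]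
    have e : ∀ i : Fin Nb, n + ((s1 i : ℕ) : ℤ) = n + 1 + (i : ℤ) := by
      intro i; simp [s1]; ring
    simp only [V, D', e]
  have hc : ∀ s, ¬ Function.Injective s → c s = 0 := by
    intro s hs
    simp only [Function.Injective, not_forall] at hs
    obtain ⟨i, j, hij, hne⟩ := hs
    have : (Matrix.of (fun l i => V i (s l))).det = 0 :=
      Matrix.det_zero_of_row_eq hne (by ext k; simp [hij])
    simp [c, this]
  have hprod : ∀ (S : Finset (Fin (Na + Nb))), S.card = Nb → ∀ s : Fin Nb → Fin (Na + Nb),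
      Function.Injective s →
      (∏ i, (if s i ∈ S then (1:ℝ) else 0)) = if Finset.univ.image s = S then 1 else 0 := by
    intro S hS s hs
    split_ifs with h
    · refine Finset.prod_eq_one fun i _ => ?_
      rw [if_pos]; rw [← h]; exact Finset.mem_image_of_mem _ (Finset.mem_univ _)
    · by_contra hcon
      apply h
      apply Finset.eq_of_subset_of_card_le
      · intro m hm
        obtain ⟨i, -, rfl⟩ := Finset.mem_image.mp hm
        by_contra hm'
        exact hcon (Finset.prod_eq_zero (Finset.mem_univ i) (if_neg hm'))
      · rw [hS, Finset.card_image_of_injective _ hs]; simp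
  have card0 : (Finset.univ.image s0).card = Nb := by
    rw [Finset.card_image_of_injective _ hs0]; simp
  have card1 : (Finset.univ.image s1).card = Nb := by
    rw [Finset.card_image_of_injective _ hs1]; simp
  have hsum : ∀ (s : Fin Nb → Fin (Na + Nb)), Function.Injective s → ∀ f : Fin (Na + Nb) → ℝ,
      ∑ i, f (s i) = ∑ m ∈ Finset.univ.image s, f m := by
    intro s hs f
    rw [Finset.sum_image (fun a _ b _ h => hs h)]
  have key : ∀ j, Real.exp (-(∑ l ∈ Finset.Icc n (n + (Nb : ℤ) - 1), Kf κ l (x j))) *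
            tauf Na Nb κ D (x j) -
          (zc Na Nb hN κ D n + zc Na Nb hN κ D (n + 1) *
              Real.exp (Kf κ (n + (Nb : ℤ)) (x j) - Kf κ n (x j))) =
      ∑ s : Fin Nb → Fin (Na + Nb), (Real.exp (∑ i, Kf κ (n + ((s i : ℕ) : ℤ)) (x j) -
          ∑ i, Kf κ (n + ((s0 i : ℕ) : ℤ)) (x j)) -
        ((∏ i, (if s i ∈ Finset.univ.image s0 then (1:ℝ) else 0)) +
        (∏ i, (if s i ∈ Finset.univ.image s1 then (1:ℝ) else 0)) *
          Real.exp (Kf κ (n + (Nb : ℤ)) (x j) - Kf κ n (x j)))) * c s := by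
    intro j
    rw [hz0, hz1, aux_tau Na Nb hN κ hper' D n (x j),
      aux_det (Na + Nb) Nb V D' (fun m => Real.exp (Kf κ (n + (m : ℤ)) (x j))), aux_icc,
      Finset.mul_sum, Finset.sum_mul, ← Finset.sum_add_distrib, ← Finset.sum_sub_distrib]
    refine Finset.sum_congr rfl fun s _ => ?_
    rw [sub_eq_neg_add (∑ i, Kf κ (n + ((s i : ℕ) : ℤ)) (x j)), Real.exp_add, ← Real.exp_sum]
    simp only [s0, c]
    ring
  simp_rw [key]
  have hzero : ∑ s : Fin Nb → Fin (Na + Nb), (0:ℝ) = 0 := by simp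
  refine Eq.subst (motive := fun r => Tendsto _ atTop (nhds r)) hzero ?_
  refine tendsto_finsetSum _ fun s _ => ?_
  by_cases hs : Function.Injective s
  swap
  · simp [hc s hs]
  refine Eq.subst (motive := fun r => Tendsto _ atTop (nhds r)) (zero_mul (c s)) ?_
  refine Tendsto.mul_const _ ?_
  simp_rw [hprod _ card0 s hs, hprod _ card1 s hs]
  have hne : Finset.univ.image s0 ≠ Finset.univ.image s1 := by
    intro h
    have : (⟨0, hN⟩ : Fin (Na + Nb)) ∈ Finset.univ.image s0 := by rw [im0]; simp [hNb]
    rw [h, im1] at this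
    simp at this
  by_cases hS0 : Finset.univ.image s = Finset.univ.image s0
  · have h1 : ¬ Finset.univ.image s = Finset.univ.image s1 := by rw [hS0]; exact hne
    have h2 : ∀ j, ∑ i, Kf κ (n + ((s i : ℕ) : ℤ)) (x j) =
        ∑ i, Kf κ (n + ((s0 i : ℕ) : ℤ)) (x j) := by
      intro j
      rw [hsum s hs (fun m => Kf κ (n + ((m : ℕ) : ℤ)) (x j)),
        hsum s0 hs0 (fun m => Kf κ (n + ((m : ℕ) : ℤ)) (x j)), hS0]
    simp only [h2, if_pos hS0, if_neg h1]
    simp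
  by_cases hS1 : Finset.univ.image s = Finset.univ.image s1
  · have h2 : ∀ j, ∑ i, Kf κ (n + ((s i : ℕ) : ℤ)) (x j) -
        ∑ i, Kf κ (n + ((s0 i : ℕ) : ℤ)) (x j) = Kf κ (n + (Nb : ℤ)) (x j) - Kf κ n (x j) := by
      intro j
      rw [hsum s hs (fun m => Kf κ (n + ((m : ℕ) : ℤ)) (x j)), hS1,
        ← hsum s1 hs1 (fun m => Kf κ (n + ((m : ℕ) : ℤ)) (x j)), ← Finset.sum_sub_distrib]
      have := Finset.sum_range_sub (fun k : ℕ => Kf κ (n + (k : ℤ)) (x j)) Nb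
      rw [← Fin.sum_univ_eq_sum_range
        (fun k : ℕ => Kf κ (n + ((k + 1 : ℕ) : ℤ)) (x j) - Kf κ (n + (k : ℤ)) (x j))] at this
      simpa [s0, s1] using this
    simp only [h2, if_pos hS1, if_neg hS0]
    simp
  simp only [if_neg hS0, if_neg hS1]
  simp only [zero_mul, add_zero, sub_zero]
  have hlin : ∀ v : ℝ × ℝ, ∑ i, Kf κ (n + ((s i : ℕ) : ℤ)) v - ∑ i, Kf κ (n + ((s0 i : ℕ) : ℤ)) v =
      (∑ i, κ (n + ((s i : ℕ) : ℤ)) - ∑ i, κ (n + ((s0 i : ℕ) : ℤ))) * v.1 +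
      (∑ i, κ (n + ((s i : ℕ) : ℤ)) ^ 2 - ∑ i, κ (n + ((s0 i : ℕ) : ℤ)) ^ 2) * v.2 := by
    intro v
    simp only [Kf, Finset.sum_add_distrib, ← Finset.sum_mul]
    ring
  simp_rw [hlin]
  refine aux_lim _ _ (yv κ Nb n) x α hα C hC ?_
  rw [← hlin]
  let q : Fin (Na + Nb) → ℝ := fun m =>
    Kf κ (n + ((m : ℕ) : ℤ)) (yv κ Nb n) - Kf κ n (yv κ Nb n)
  have hq := aux_comb (Na + Nb) Nb hNb (by omega) q
    (by
      rintro m (h | h)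
      · simp [q, h]
      · simp only [q, aux_q, h]; ring)
    (by
      intro m h1 h2
      simp only [q, aux_q]
      exact aux_sign _ _ _ (aux_cyc (Na + Nb) hN κ hper' hmono' n m Nb (by omega) (by omega)
        (by push_cast; omega)))
    (by
      intro m h1
      simp only [q, aux_q]
      have := aux_sign _ _ _ (aux_cyc (Na + Nb) hN κ hper' hmono' n Nb m (by omega) (by omega)
        (by have := m.2; omega))
      nlinarith [this])
    (Finset.univ.image s) (by rw [Finset.card_image_of_injective _ hs]; simp)
    (by rw [← im0]; exact hS0) (by rw [← im1]; exact hS1)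
  rw [← im0, ← hsum s hs q, ← hsum s0 hs0 q] at hq
  simp only [q, Finset.sum_sub_distrib] at hq
  linarith

end
end

section
/- For every integer n and every x ∈ ℝ², τ(x) = Σ_{n ≤ n_1 < n_2 < ⋯ < n_{N_b} ≤ N + n − 1} f_{n_1,…,n_{N_b}} · ∏_{l=1}^{N_b} e^{K_{n_l}(x)}; in particular the right-hand side is independent of n. -/
noncomputable section

open Filter Matrix

theorem cauchy_binet_aux {m N : ℕ} (A : Matrix (Fin m) (Fin N) ℝ) (B : Matrix (Fin N) (Fin m) ℝ) :
    (A * B).det = ∑ f : Fin m → Fin N, (A.submatrix id f).det * ∏ i, B (f i) i := by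
  simp only [Matrix.det_apply', Matrix.mul_apply, Finset.prod_univ_sum, Fintype.piFinset_univ,
    Finset.mul_sum, Finset.sum_mul]
  rw [Finset.sum_comm]
  refine Finset.sum_congr rfl fun f _ => Finset.sum_congr rfl fun σ _ => ?_
  simp [Finset.prod_mul_distrib, mul_assoc]

theorem cauchy_binet_fin {m N : ℕ} (A : Matrix (Fin m) (Fin N) ℝ) (B : Matrix (Fin N) (Fin m) ℝ) :
    (A * B).det = ∑ s ∈ Finset.univ.filter
          (fun s : Fin m → Fin N => ∀ i j : Fin m, i < j → s i < s j),
      (A.submatrix id s).det * (B.submatrix s id).det := by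
  classical
  rw [cauchy_binet_aux]
  have h1 : ∑ f : Fin m → Fin N, (A.submatrix id f).det * ∏ i, B (f i) i =
      ∑ f ∈ Finset.univ.filter (fun f : Fin m → Fin N => Function.Injective f),
        (A.submatrix id f).det * ∏ i, B (f i) i := by
    symm
    apply Finset.sum_subset (Finset.subset_univ _)
    intro f _ hf
    have hf' : ¬ Function.Injective f := by simpa using hf
    simp only [Function.Injective, not_forall] at hf'
    obtain ⟨i, j, hij, hne⟩ := hf'
    rw [Matrix.det_zero_of_column_eq hne (by intro k; simp [hij]), zero_mul]
  have h2 : ∀ s : Fin m → Fin N, (A.submatrix id s).det * (B.submatrix s id).det =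
      ∑ σ : Equiv.Perm (Fin m), (A.submatrix id (s ∘ σ)).det * ∏ i, B (s (σ i)) i := by
    intro s
    rw [Matrix.det_apply' (B.submatrix s id), Finset.mul_sum]
    refine Finset.sum_congr rfl fun σ _ => ?_
    have := Matrix.det_permute' σ (A.submatrix id s)
    rw [Matrix.submatrix_submatrix] at this
    simp only [Function.comp_id] at this
    rw [this]
    simp only [Matrix.submatrix_apply, id]
    ring
  rw [h1, Finset.sum_congr rfl fun s _ => h2 s, ← Finset.sum_product']
  symm
  refine Finset.sum_nbij (fun p => p.1 ∘ p.2) ?_ ?_ ?_ ?_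
  · rintro ⟨s, σ⟩ h
    simp only [Finset.mem_product, Finset.mem_filter, Finset.mem_univ, true_and, and_true] at h ⊢
    have hs : StrictMono s := fun i j => h i j
    exact hs.injective.comp σ.injective
  · rintro ⟨s, σ⟩ h ⟨s', σ'⟩ h' he
    simp only [Finset.coe_product, Finset.coe_filter, Finset.coe_univ, Set.mem_prod,
      Set.mem_setOf_eq, Finset.mem_univ, true_and, Set.mem_univ, and_true] at h h'
    have hs : StrictMono s := fun i j => h i j
    have hs' : StrictMono s' := fun i j => h' i j
    have he' : s ∘ σ = s' ∘ σ' := he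
    have hr : Set.range s = Set.range s' := by
      rw [← σ.surjective.range_comp s, he', σ'.surjective.range_comp]
    have e := (hs.range_inj hs').1 hr
    subst e
    have : σ = σ' := by
      ext i
      exact congrArg Fin.val (hs.injective (congrFun he' i))
    rw [this]
  · intro f hf
    have hf' : Function.Injective f := by simpa using hf
    refine ⟨(f ∘ Tuple.sort f, (Tuple.sort f)⁻¹), ?_, ?_⟩
    · have : StrictMono (f ∘ Tuple.sort f) :=
        (Tuple.monotone_sort f).strictMono_of_injective (hf'.comp (Tuple.sort f).injective)
      simp only [Finset.coe_product, Finset.coe_filter, Finset.coe_univ, Set.mem_prod,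
        Set.mem_setOf_eq, Finset.mem_univ, true_and, Set.mem_univ, and_true]
      exact fun i j h => this h
    · funext i
      simp
  · rintro ⟨s, σ⟩ _
    rfl

theorem idx_spec (N : ℕ) (hN : 0 < N) (m : ℤ) :
    ((idx N hN m : ℕ) : ℤ) = (m - 1) % (N : ℤ) := by
  have h1 : 0 ≤ (m - 1) % (N : ℤ) := Int.emod_nonneg _ (by exact_mod_cast hN.ne')
  simp [idx, h1]

theorem idx_bij (N : ℕ) (hN : 0 < N) (n : ℤ) :
    Function.Bijective (fun k : Fin N => idx N hN (n + (k : ℤ))) := by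
  rw [← Finite.injective_iff_bijective]
  intro a b h
  have h' : ((idx N hN (n + (a : ℤ)) : ℕ) : ℤ) = ((idx N hN (n + (b : ℤ)) : ℕ) : ℤ) := by
    have h0 : idx N hN (n + (a : ℤ)) = idx N hN (n + (b : ℤ)) := h
    rw [h0]
  rw [idx_spec, idx_spec] at h'
  have h4 : (N : ℤ) ∣ ((a : ℤ) - (b : ℤ)) := by
    have := Int.ModEq.dvd (show (n + (b : ℤ) - 1) ≡ (n + (a : ℤ) - 1) [ZMOD N] from h'.symm)
    convert this using 1
    ring
  have ha := a.2
  have hb := b.2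
  have := Int.eq_zero_of_abs_lt_dvd h4 (by rw [abs_lt]; constructor <;> omega)
  ext
  omega

theorem kappa_idx (N : ℕ) (hN : 0 < N) (κ : ℤ → ℝ) (hper : ∀ k : ℤ, κ (k + (N : ℤ)) = κ k)
    (m : ℤ) : κ ((idx N hN m : ℕ) + 1) = κ m := by
  have hp : Function.Periodic κ (N : ℤ) := hper
  have h := hp.int_mul ((m - 1) / (N : ℤ)) ((idx N hN m : ℕ) + 1)
  rw [← h, idx_spec]
  congr 1
  have := Int.emod_add_mul_ediv (m - 1) (N : ℤ)
  simp only [Int.cast_id]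
  linarith [mul_comm (N : ℤ) ((m - 1) / (N : ℤ))]

/-- for every integer `n` and every `x ∈ ℝ²`,
`τ(x) = Σ_{n ≤ n_1 < ⋯ < n_{N_b} ≤ N+n−1} f_{n_1,…,n_{N_b}} ∏_{l=1}^{N_b} e^{K_{n_l}(x)}`;
the multi-indices `n ≤ n_1 < ⋯ < n_{N_b} ≤ N + n − 1` are encoded as `n_i = n + s i`
with `s : Fin N_b → Fin (N_a + N_b)` strictly monotone.  Since this holds for every `n`
and the left-hand side does not involve `n`, the right-hand side is independent of `n`. -/
theorem statement8 (Na Nb : ℕ) (hNa : 0 < Na) (hNb : 0 < Nb)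
    (κ : ℤ → ℝ)
    (hper : ∀ k : ℤ, κ (k + (Na + Nb : ℤ)) = κ k)
    (hmono : ∀ k k' : ℤ, 1 ≤ k → k < k' → k' ≤ (Na + Nb : ℤ) → κ k < κ k')
    (D : Matrix (Fin (Na + Nb)) (Fin Nb) ℝ)
    (n : ℤ) (x : ℝ × ℝ) :
    tauf Na Nb κ D x =
      ∑ s ∈ Finset.univ.filter
          (fun s : Fin Nb → Fin (Na + Nb) => ∀ i j : Fin Nb, i < j → s i < s j),
        fcoef Na Nb (Nat.add_pos_left hNa Nb) κ D (fun i => n + (s i : ℤ)) *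
          ∏ i : Fin Nb, Real.exp (Kf κ (n + (s i : ℤ)) x) := by
  have hN : 0 < Na + Nb := Nat.add_pos_left hNa Nb
  have hκ : ∀ m : ℤ, κ ((idx (Na + Nb) hN m : ℕ) + 1) = κ m :=
    kappa_idx (Na + Nb) hN κ (by intro k; push_cast; exact hper k)
  let e : Fin (Na + Nb) ≃ Fin (Na + Nb) := Equiv.ofBijective _ (idx_bij (Na + Nb) hN n)
  have he : ∀ k, e k = idx (Na + Nb) hN (n + (k : ℤ)) := fun k => rfl
  unfold tauf
  rw [show ∀ (A : Matrix (Fin Nb) (Fin (Na + Nb)) ℝ), A * D =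
    A.submatrix id e * D.submatrix e id from fun A => by
      rw [Matrix.submatrix_mul_equiv]; rfl]
  rw [cauchy_binet_fin]
  refine Finset.sum_congr rfl fun s _ => ?_
  have hA : ((Matrix.of (fun (i : Fin Nb) (n : Fin (Na + Nb)) => κ ((n : ℤ) + 1) ^ (i : ℕ)) *
      Matrix.diagonal (fun n : Fin (Na + Nb) => Real.exp (Kf κ ((n : ℤ) + 1) x))).submatrix id
        e).submatrix id s = Matrix.of (fun i j => Real.exp (Kf κ (n + (s j : ℤ)) x) *
          (Matrix.vandermonde (fun i => κ (n + (s i : ℤ))))ᵀ i j) := by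
    ext i j
    simp only [Matrix.submatrix_apply, Matrix.mul_diagonal, Matrix.of_apply, id, he,
      Matrix.transpose_apply, Matrix.vandermonde_apply, Kf, hκ]
    ring
  rw [hA, Matrix.det_mul_row, Matrix.det_transpose, Matrix.det_vandermonde]
  unfold fcoef
  have hp : ∏ p ∈ Finset.univ.filter (fun p : Fin Nb × Fin Nb => p.1 < p.2),
      (κ (n + (s p.2 : ℤ)) - κ (n + (s p.1 : ℤ))) =
      ∏ i : Fin Nb, ∏ j ∈ Finset.Ioi i, (κ (n + (s j : ℤ)) - κ (n + (s i : ℤ))) := by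
    rw [Finset.prod_filter, ← Finset.univ_product_univ, Finset.prod_product]
    refine Finset.prod_congr rfl fun i _ => ?_
    rw [← Finset.prod_filter]
    refine Finset.prod_congr (by ext; simp) fun _ _ => rfl
  rw [hp]
  have hD : (D.submatrix e id).submatrix s id =
      Matrix.of (fun i l => D (idx (Na + Nb) (Nat.add_pos_left hNa Nb) (n + (s i : ℤ))) l) := rfl
  rw [hD]
  ring

end
end

section
/- If f_{n_1,…,n_{N_b}} ≥ 0 for all 1 ≤ n_1 < ⋯ < n_{N_b} ≤ N, and f_{n_1,…,n_{N_b}} > 0 for at least one such multi-index, then τ(x) > 0 for every x ∈ ℝ². -/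
noncomputable section

open Filter Matrix

/-- The coefficient `f_{n_1,…,n_{N_b}} = ∏_{i<j} (κ_{n_j} − κ_{n_i}) · Д(n_1,…,n_{N_b})`
for a strictly increasing multi-index `1 ≤ n_1 < ⋯ < n_{N_b} ≤ N`, encoded by a
strictly monotone `s : Fin N_b → Fin (N_a + N_b)` (with `n_i = s(i) + 1`);
`Д(n_1,…,n_{N_b})` is the maximal minor of `Д` formed by the rows `n_1, …, n_{N_b}`. -/
def fcoefFin (Na Nb : ℕ) (κ : ℤ → ℝ) (D : Matrix (Fin (Na + Nb)) (Fin Nb) ℝ)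
    (s : Fin Nb → Fin (Na + Nb)) : ℝ :=
  (∏ p ∈ Finset.univ.filter (fun p : Fin Nb × Fin Nb => p.1 < p.2),
      (κ ((s p.2 : ℤ) + 1) - κ ((s p.1 : ℤ) + 1))) *
    (Matrix.of (fun i l => D (s i) l)).det

theorem aux_cb1 {m N : ℕ} (A : Matrix (Fin m) (Fin N) ℝ) (B : Matrix (Fin N) (Fin m) ℝ) :
    (A * B).det = ∑ s : Fin m → Fin N, (∏ i, A i (s i)) * (Matrix.of fun i l => B (s i) l).det := by
  have h : A * B = fun i => ∑ n, A i n • B n := by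
    funext i j
    simp [Matrix.mul_apply, Finset.sum_apply]
  have h2 := (Matrix.detRowAlternating (n := Fin m) (R := ℝ)).toMultilinearMap.map_sum
    (fun i (n : Fin N) => A i n • B n)
  have h3 : (A * B).det = (Matrix.detRowAlternating (n := Fin m) (R := ℝ)).toMultilinearMap
      (fun i => ∑ n, A i n • B n) := by
    rw [h]; rfl
  rw [h3, h2]
  refine Finset.sum_congr rfl fun s _ => ?_
  rw [MultilinearMap.map_smul_univ]
  rfl

theorem aux_permB {m N : ℕ} (B : Matrix (Fin N) (Fin m) ℝ) (s : Fin m → Fin N)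
    (σ : Equiv.Perm (Fin m)) :
    (Matrix.of fun i l => B (s (σ i)) l).det
      = (Equiv.Perm.sign σ : ℝ) * (Matrix.of fun i l => B (s i) l).det :=
  Matrix.det_permute σ (Matrix.of fun i l => B (s i) l)

theorem aux_cb {m N : ℕ} (A : Matrix (Fin m) (Fin N) ℝ) (B : Matrix (Fin N) (Fin m) ℝ) :
    (Nat.factorial m : ℝ) * (A * B).det = ∑ s : Fin m → Fin N,
      (Matrix.of fun i l => A l (s i)).det * (Matrix.of fun i l => B (s i) l).det := by
  have h : ∀ σ : Equiv.Perm (Fin m), (A * B).det = ∑ s : Fin m → Fin N,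
      ((Equiv.Perm.sign σ : ℝ) * ∏ i, A i (s (σ i))) * (Matrix.of fun i l => B (s i) l).det := by
    intro σ
    rw [aux_cb1, ← Equiv.sum_comp (Equiv.arrowCongr σ (Equiv.refl (Fin N))).symm]
    refine Finset.sum_congr rfl fun s _ => ?_
    have := aux_permB B s σ
    simp only [Equiv.arrowCongr_symm, Equiv.arrowCongr_apply, Equiv.symm_symm, Equiv.refl_symm,
      Equiv.coe_refl, Function.comp_apply, id] at *
    rw [this]; ring
  have h2 : ∑ σ : Equiv.Perm (Fin m), (A * B).det = (Nat.factorial m : ℝ) * (A * B).det := by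
    simp [Fintype.card_perm]
  rw [← h2, Finset.sum_congr rfl fun σ _ => h σ, Finset.sum_comm]
  refine Finset.sum_congr rfl fun s _ => ?_
  rw [← Finset.sum_mul, Matrix.det_apply' (Matrix.of fun i l => A l (s i))]
  rfl

/-- if `f_{n_1,…,n_{N_b}} ≥ 0` for all `1 ≤ n_1 < ⋯ < n_{N_b} ≤ N` and
`f_{n_1,…,n_{N_b}} > 0` for at least one such multi-index, then `τ(x) > 0` for every
`x ∈ ℝ²`. -/
theorem statement9 (Na Nb : ℕ) (hNa : 0 < Na) (hNb : 0 < Nb)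
    (κ : ℤ → ℝ)
    (hmono : ∀ k k' : ℤ, 1 ≤ k → k < k' → k' ≤ (Na + Nb : ℤ) → κ k < κ k')
    (D : Matrix (Fin (Na + Nb)) (Fin Nb) ℝ)
    (hnonneg : ∀ s : Fin Nb → Fin (Na + Nb),
      (∀ i j : Fin Nb, i < j → s i < s j) → 0 ≤ fcoefFin Na Nb κ D s)
    (hpos : ∃ s : Fin Nb → Fin (Na + Nb),
      (∀ i j : Fin Nb, i < j → s i < s j) ∧ 0 < fcoefFin Na Nb κ D s) :
    ∀ x : ℝ × ℝ, 0 < tauf Na Nb κ D x := by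
  intro x
  set A : Matrix (Fin Nb) (Fin (Na + Nb)) ℝ :=
    Matrix.of (fun (i : Fin Nb) (n : Fin (Na + Nb)) => κ ((n : ℤ) + 1) ^ (i : ℕ)) *
    Matrix.diagonal (fun n : Fin (Na + Nb) => Real.exp (Kf κ ((n : ℤ) + 1) x)) with hA
  have hAD : ∀ s : Fin Nb → Fin (Na + Nb),
      (Matrix.of fun i l => A l (s i)).det * (Matrix.of fun i l => D (s i) l).det
      = (∏ i, Real.exp (Kf κ ((s i : ℤ) + 1) x)) * fcoefFin Na Nb κ D s := by
    intro s
    have h1 : (Matrix.of fun i l => A l (s i)) = Matrix.of (fun i l =>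
        Real.exp (Kf κ ((s i : ℤ) + 1) x) *
          (Matrix.vandermonde fun i => κ ((s i : ℤ) + 1)) i l) := by
      ext i l
      simp [hA, Matrix.mul_diagonal, Matrix.vandermonde_apply, mul_comm]
    rw [h1, Matrix.det_mul_column, Matrix.det_vandermonde, fcoefFin, mul_assoc]
    congr 2
    rw [Finset.prod_filter, Fintype.prod_prod_type]
    refine Finset.prod_congr rfl fun i _ => ?_
    rw [← Finset.prod_filter]
    refine Finset.prod_congr ?_ fun _ _ => rfl
    ext j; simp
  have hexp : ∀ s : Fin Nb → Fin (Na + Nb), 0 < ∏ i, Real.exp (Kf κ ((s i : ℤ) + 1) x) :=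
    fun s => Finset.prod_pos fun i _ => Real.exp_pos _
  have hcb := aux_cb A D
  have hsum : 0 < ∑ s : Fin Nb → Fin (Na + Nb),
      (Matrix.of fun i l => A l (s i)).det * (Matrix.of fun i l => D (s i) l).det := by
    refine Finset.sum_pos' (fun s _ => ?_) ?_
    · by_cases hs : Function.Injective s
      · have hm : StrictMono (s ∘ Tuple.sort s) :=
          (Tuple.monotone_sort s).strictMono_of_injective
            (hs.comp (Tuple.sort s).injective)
        have h1 := hAD (s ∘ Tuple.sort s)
        have h2 := mul_nonneg (hexp (s ∘ Tuple.sort s)).le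
          (hnonneg (s ∘ Tuple.sort s) fun i j hij => hm hij)
        rw [← h1] at h2
        simp only [Function.comp_apply] at h2
        have h4 : (Matrix.of fun i l => A l (s (Tuple.sort s i))).det
            = (Equiv.Perm.sign (Tuple.sort s) : ℝ) * (Matrix.of fun i l => A l (s i)).det :=
          aux_permB Aᵀ s (Tuple.sort s)
        rw [aux_permB D s, h4] at h2
        have h3 : ((Equiv.Perm.sign (Tuple.sort s) : ℤ) : ℝ) *
            ((Equiv.Perm.sign (Tuple.sort s) : ℤ) : ℝ) = 1 := by
          rw [← Int.cast_mul, ← Units.val_mul, Int.units_mul_self]; simp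
        rw [mul_mul_mul_comm, h3, one_mul] at h2
        exact h2
      · simp only [Function.Injective, not_forall] at hs
        obtain ⟨i, j, hij, hne⟩ := hs
        have : (Matrix.of fun i l => D (s i) l).det = 0 :=
          Matrix.det_zero_of_row_eq hne (by ext l; simp [hij])
        rw [this, mul_zero]
    · obtain ⟨s, _, hs⟩ := hpos
      refine ⟨s, Finset.mem_univ _, ?_⟩
      rw [hAD]
      exact mul_pos (hexp s) hs
  rw [← hcb] at hsum
  exact pos_of_mul_pos_right hsum (by positivity)

end
end

section
/- Suppose Д has rank N_b and Д′ is a real N_a×N matrix of rank N_a with Д′Д = 0. Then there exists a nonzero constant c, independent of x, such that τ(x) = c · (∏_{n=1}^{N} e^{K_n(x)}) · τ′(x) for all x ∈ ℝ². -/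
noncomputable section

open Matrix

/-- The dual τ-function `τ′(x) = det (Д′ e^{−K(x)} γ V′)`, where
`γ = diag(γ_n)` with `γ_n = ∏_{n′ ≠ n} (κ_n − κ_{n′})⁻¹`, and `V′` is the `N × N_a`
incomplete Vandermonde matrix `(V′)_{n,j} = κ_n^{j−1}`. -/
def tauf' (Na Nb : ℕ) (κ : ℤ → ℝ) (D' : Matrix (Fin Na) (Fin (Na + Nb)) ℝ)
    (x : ℝ × ℝ) : ℝ :=
  (D' *
    Matrix.diagonal (fun n : Fin (Na + Nb) => Real.exp (-Kf κ ((n : ℤ) + 1) x)) *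
    Matrix.diagonal (fun n : Fin (Na + Nb) =>
      ∏ n' ∈ Finset.univ.erase n, (κ ((n : ℤ) + 1) - κ ((n' : ℤ) + 1))⁻¹) *
    Matrix.of (fun (n : Fin (Na + Nb)) (j : Fin Na) => κ ((n : ℤ) + 1) ^ (j : ℕ))).det

theorem aux_key {m k n : Type*} [Fintype m] [Fintype k] [Fintype n] [DecidableEq m]
    [DecidableEq k] [DecidableEq n] (e : m ⊕ k ≃ n)
    (V : Matrix m n ℝ) (T : Matrix n m ℝ) (G : Matrix n k ℝ) (W : Matrix k n ℝ)
    (D : Matrix n m ℝ) (L : Matrix m n ℝ) (D' : Matrix k n ℝ) (S : Matrix n k ℝ)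
    (hVT : V * T = 1) (hWG : W * G = 1) (hVG : V * G = 0)
    (hLD : L * D = 1) (hDS : D' * S = 1) (hDD : D' * D = 0) :
    ∃ c : ℝ, c ≠ 0 ∧ ∀ E E' : Matrix n n ℝ, E * E' = 1 →
      (V * E * D).det = c * E.det * (D' * E' * G).det := by
  have hmul : ∀ (X : Matrix (m ⊕ k) n ℝ) (Y : Matrix n (m ⊕ k) ℝ),
      (X * Y).det = (X.submatrix id e).det * (Y.submatrix e id).det := by
    intro X Y
    rw [← det_mul, Matrix.submatrix_mul_equiv, Matrix.submatrix_id_id]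
  have hP : ((fromCols D S).submatrix e id).det ≠ 0 := by
    have h := hmul (fromRows L D') (fromCols D S)
    rw [fromRows_mul_fromCols, hLD, hDS, hDD, det_fromBlocks_zero₂₁, det_one, det_one] at h
    intro h0
    rw [h0] at h
    norm_num at h
  have hQ : ((fromCols T G).submatrix e id).det ≠ 0 := by
    have h := hmul (fromRows V W) (fromCols T G)
    rw [fromRows_mul_fromCols, hVT, hWG, hVG, det_fromBlocks_zero₁₂, det_one, det_one] at h
    intro h0
    rw [h0] at h
    norm_num at h
  refine ⟨_, div_ne_zero hP hQ, fun E E' hE => ?_⟩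
  have hE' : E.det * E'.det = 1 := by rw [← det_mul, hE, det_one]
  have h1 := hmul (fromRows (V * E) D') (fromCols D S)
  rw [fromRows_mul_fromCols, hDS, hDD, det_fromBlocks_zero₂₁, det_one, mul_one] at h1
  have h2 := hmul (fromRows (V * E) D') (E' * fromCols T G)
  have h3 : ((E' * fromCols T G).submatrix e id).det =
      E'.det * ((fromCols T G).submatrix e id).det := by
    rw [← det_submatrix_equiv_self e E', ← det_mul, Matrix.submatrix_mul_equiv]
  have a1 : V * E * (E' * T) = 1 := by
    rw [Matrix.mul_assoc, ← Matrix.mul_assoc E, hE, Matrix.one_mul, hVT]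
  have a2 : V * E * (E' * G) = 0 := by
    rw [Matrix.mul_assoc, ← Matrix.mul_assoc E, hE, Matrix.one_mul, hVG]
  rw [h3, mul_fromCols, fromRows_mul_fromCols, a1, a2, det_fromBlocks_zero₁₂, det_one, one_mul,
    ← Matrix.mul_assoc] at h2
  rw [h1, h2]
  field_simp
  linear_combination (-((fromRows (V * E) D').submatrix id e).det) * hE'

theorem aux_left {m n : Type*} [Fintype m] [Fintype n] [DecidableEq m]
    [DecidableEq n] (D : Matrix n m ℝ) (h : D.rank = Fintype.card m) :
    ∃ L : Matrix m n ℝ, L * D = 1 := by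
  have hinj : LinearMap.ker D.mulVecLin = ⊥ := by
    have h1 := LinearMap.finrank_range_add_finrank_ker D.mulVecLin
    have h2 : Module.finrank ℝ (LinearMap.range D.mulVecLin) = Fintype.card m := h
    rw [h2, Module.finrank_fintype_fun_eq_card] at h1
    exact Submodule.finrank_eq_zero.mp (by omega)
  obtain ⟨g, hg⟩ := LinearMap.exists_leftInverse_of_injective _ hinj
  refine ⟨LinearMap.toMatrix' g, ?_⟩
  have := congrArg LinearMap.toMatrix' hg
  rw [LinearMap.toMatrix'_comp, LinearMap.toMatrix'_id] at this
  rw [← this]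
  congr 1
  exact (LinearMap.toMatrix'_toLin' D).symm

theorem aux_right {m n : Type*} [Fintype m] [Fintype n] [DecidableEq m]
    [DecidableEq n] (D : Matrix m n ℝ) (h : D.rank = Fintype.card m) :
    ∃ L : Matrix n m ℝ, D * L = 1 := by
  obtain ⟨L, hL⟩ := aux_left Dᵀ (by rw [rank_transpose, h])
  refine ⟨Lᵀ, ?_⟩
  have := congrArg transpose hL
  rwa [transpose_mul, transpose_transpose, transpose_one] at this

theorem aux_vand {N M : ℕ} (hM : M ≤ N) (v : Fin N → ℝ) (hv : Function.Injective v) :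
    ∃ W : Matrix (Fin M) (Fin N) ℝ,
      W * Matrix.of (fun (n : Fin N) (j : Fin M) => v n ^ (j : ℕ)) = 1 := by
  have hdet : IsUnit (vandermonde v).det :=
    isUnit_iff_ne_zero.mpr (det_vandermonde_ne_zero_iff.mpr hv)
  refine ⟨((vandermonde v)⁻¹).submatrix (Fin.castLE hM) id, ?_⟩
  have h := nonsing_inv_mul _ hdet
  have h2 : Matrix.of (fun (n : Fin N) (j : Fin M) => v n ^ (j : ℕ)) =
      (vandermonde v).submatrix id (Fin.castLE hM) := by
    ext i j; simp [vandermonde_apply]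
  rw [h2, ← Matrix.submatrix_mul _ _ _ id _ Function.bijective_id, h]
  exact submatrix_one _ (Fin.castLE_injective hM)

/-- if `Д` has rank `N_b` and `Д′` is a real `N_a × N` matrix of rank
`N_a` with `Д′ Д = 0`, then there is a nonzero constant `c`, independent of `x`, with
`τ(x) = c · (∏_{n=1}^N e^{K_n(x)}) · τ′(x)` for all `x ∈ ℝ²`. -/
theorem statement10 (Na Nb : ℕ) (hNa : 0 < Na) (hNb : 0 < Nb)
    (κ : ℤ → ℝ)
    (hmono : ∀ k k' : ℤ, 1 ≤ k → k < k' → k' ≤ (Na + Nb : ℤ) → κ k < κ k')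
    (D : Matrix (Fin (Na + Nb)) (Fin Nb) ℝ) (hD : D.rank = Nb)
    (D' : Matrix (Fin Na) (Fin (Na + Nb)) ℝ) (hD' : D'.rank = Na)
    (horth : D' * D = 0) :
    ∃ c : ℝ, c ≠ 0 ∧ ∀ x : ℝ × ℝ,
      tauf Na Nb κ D x =
        c * (∏ n : Fin (Na + Nb), Real.exp (Kf κ ((n : ℤ) + 1) x)) * tauf' Na Nb κ D' x := by
  set v : Fin (Na + Nb) → ℝ := fun n => κ ((n : ℤ) + 1) with hvdef
  have hvlt : ∀ a b : Fin (Na + Nb), a < b → v a < v b := by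
    intro a b hab
    have hb := b.2
    have hab' : (a : ℕ) < (b : ℕ) := hab
    exact hmono _ _ (by omega) (by omega) (by omega)
  have hv : Function.Injective v := (show StrictMono v from fun a b h => hvlt a b h).injective
  set g : Fin (Na + Nb) → ℝ := fun n => ∏ n' ∈ Finset.univ.erase n, (v n - v n')⁻¹ with hg
  have hg0 : ∀ n, g n ≠ 0 := by
    intro n
    refine Finset.prod_ne_zero_iff.mpr fun n' hn' => inv_ne_zero (sub_ne_zero.mpr ?_)
    exact fun h => (Finset.mem_erase.mp hn').1 (hv h).symm
  obtain ⟨L, hL⟩ := aux_left D (by simpa using hD)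
  obtain ⟨S, hS⟩ := aux_right D' (by simpa using hD')
  obtain ⟨W, hW⟩ := aux_vand (Nat.le_add_right Na Nb) v hv
  obtain ⟨T, hT⟩ := aux_vand (Nat.le_add_left Nb Na) v hv
  have hT' := congrArg transpose hT
  rw [transpose_mul, transpose_one] at hT'
  have hgi : diagonal (fun n => (g n)⁻¹) * diagonal g = 1 := by
    rw [diagonal_mul_diagonal, ← diagonal_one]
    congr 1; ext n; exact inv_mul_cancel₀ (hg0 n)
  obtain ⟨c, hc, h⟩ := aux_key ((Equiv.sumComm _ _).trans finSumFinEquiv)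
    (Matrix.of (fun (i : Fin Nb) (n : Fin (Na + Nb)) => v n ^ (i : ℕ))) Tᵀ
    (diagonal g * Matrix.of (fun (n : Fin (Na + Nb)) (j : Fin Na) => v n ^ (j : ℕ)))
    (W * diagonal (fun n => (g n)⁻¹)) D L D' S hT'
    (by rw [Matrix.mul_assoc, ← Matrix.mul_assoc (diagonal _), hgi, Matrix.one_mul, hW])
    (by
      ext i j
      have hlt : ((Polynomial.X : Polynomial ℝ) ^ ((i : ℕ) + (j : ℕ))).degree <
          (Finset.univ : Finset (Fin (Na + Nb))).card := by
        rw [Polynomial.degree_X_pow, Finset.card_univ, Fintype.card_fin]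
        have := i.2
        have := j.2
        exact_mod_cast (by omega : (i : ℕ) + (j : ℕ) < Na + Nb)
      have hc := Lagrange.coeff_eq_sum (s := Finset.univ) (v := v) hv.injOn hlt
      rw [Polynomial.coeff_X_pow, if_neg (by
        have := i.2
        have := j.2
        rw [Finset.card_univ, Fintype.card_fin]
        omega)] at hc
      rw [Matrix.zero_apply, hc, Matrix.mul_apply]
      refine Finset.sum_congr rfl fun n _ => ?_
      simp only [diagonal_mul, of_apply, Polynomial.eval_pow, Polynomial.eval_X, hg,
        Finset.prod_inv_distrib]
      ring)
    hL hS horth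
  refine ⟨c, hc, fun x => ?_⟩
  have hx := h (diagonal (fun n : Fin (Na + Nb) => Real.exp (Kf κ ((n : ℤ) + 1) x)))
    (diagonal (fun n : Fin (Na + Nb) => Real.exp (-Kf κ ((n : ℤ) + 1) x))) (by
      rw [diagonal_mul_diagonal, ← diagonal_one]
      congr 1; ext n
      rw [← Real.exp_add]; simp)
  rw [det_diagonal, ← Matrix.mul_assoc] at hx
  exact hx

end
end

section
/- P and P′ are complementary orthogonal projectors: P² = P, (P′)² = P′, P P′ = 0, P′ P = 0, and P + P′ = E_N, where E_N is the N×N identity matrix. -/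
open Matrix

/-- with `Д` a real `N × N_b` matrix such that `Дᵀ Д` is invertible,
`Д′` a real `N_a × N` matrix such that `Д′ Д′ᵀ` is invertible, `Д′ Д = 0`,
`P = Д (Дᵀ Д)⁻¹ Дᵀ` and `P′ = Д′ᵀ (Д′ Д′ᵀ)⁻¹ Д′`, the matrices `P` and `P′` are
complementary orthogonal projectors: `P² = P`, `(P′)² = P′`, `P P′ = 0`, `P′ P = 0`,
and `P + P′ = E_N`. -/
theorem statement11 (Na Nb : ℕ) (hNa : 0 < Na) (hNb : 0 < Nb)
    (D : Matrix (Fin (Na + Nb)) (Fin Nb) ℝ) (hD : IsUnit (Dᵀ * D))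
    (D' : Matrix (Fin Na) (Fin (Na + Nb)) ℝ) (hD' : IsUnit (D' * D'ᵀ))
    (horth : D' * D = 0) :
    (D * (Dᵀ * D)⁻¹ * Dᵀ) * (D * (Dᵀ * D)⁻¹ * Dᵀ) = D * (Dᵀ * D)⁻¹ * Dᵀ ∧
    (D'ᵀ * (D' * D'ᵀ)⁻¹ * D') * (D'ᵀ * (D' * D'ᵀ)⁻¹ * D') = D'ᵀ * (D' * D'ᵀ)⁻¹ * D' ∧
    (D * (Dᵀ * D)⁻¹ * Dᵀ) * (D'ᵀ * (D' * D'ᵀ)⁻¹ * D') = 0 ∧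
    (D'ᵀ * (D' * D'ᵀ)⁻¹ * D') * (D * (Dᵀ * D)⁻¹ * Dᵀ) = 0 ∧
    D * (Dᵀ * D)⁻¹ * Dᵀ + D'ᵀ * (D' * D'ᵀ)⁻¹ * D' = 1 := by
  have h1 : (Dᵀ * D)⁻¹ * (Dᵀ * D) = 1 :=
    Matrix.nonsing_inv_mul _ ((Matrix.isUnit_iff_isUnit_det _).1 hD)
  have h2 : (D' * D'ᵀ) * (D' * D'ᵀ)⁻¹ = 1 :=
    Matrix.mul_nonsing_inv _ ((Matrix.isUnit_iff_isUnit_det _).1 hD')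
  have horth' : Dᵀ * D'ᵀ = 0 := by
    rw [← Matrix.transpose_mul, horth, Matrix.transpose_zero]
  generalize (Dᵀ * D)⁻¹ = G at *
  generalize (D' * D'ᵀ)⁻¹ = G' at *
  refine ⟨?_, ?_, ?_, ?_, ?_⟩
  · calc _ = D * (G * (Dᵀ * D)) * (G * Dᵀ) := by simp only [Matrix.mul_assoc]
      _ = _ := by rw [h1, Matrix.mul_one, Matrix.mul_assoc]
  · calc _ = D'ᵀ * G' * ((D' * D'ᵀ) * G') * D' := by simp only [Matrix.mul_assoc]
      _ = _ := by rw [h2, Matrix.mul_one]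
  · calc _ = D * G * (Dᵀ * D'ᵀ) * (G' * D') := by simp only [Matrix.mul_assoc]
      _ = _ := by rw [horth', Matrix.mul_zero, Matrix.zero_mul]
  · calc _ = D'ᵀ * G' * (D' * D) * (G * Dᵀ) := by simp only [Matrix.mul_assoc]
      _ = _ := by rw [horth, Matrix.mul_zero, Matrix.zero_mul]
  · have key : Matrix.fromRows D' (G * Dᵀ) * Matrix.fromCols (D'ᵀ * G') D = 1 := by
      rw [Matrix.fromRows_mul_fromCols, ← Matrix.fromBlocks_one]
      congr 1
      · rw [← Matrix.mul_assoc, h2]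
      · rw [Matrix.mul_assoc, ← Matrix.mul_assoc Dᵀ, horth', Matrix.zero_mul, Matrix.mul_zero]
      · rw [Matrix.mul_assoc, h1]
    have key2 := (Matrix.mul_eq_one_comm_of_equiv (finSumFinEquiv (m := Na) (n := Nb))).1 key
    rw [Matrix.fromCols_mul_fromRows] at key2
    rw [add_comm (D * G * Dᵀ), Matrix.mul_assoc D]
    exact key2
end

section
/- If 1 ≤ m < n ≤ N and κ_{m+N_b} + κ_m = κ_{n+N_b} + κ_n (with indices taken modulo N), then m ≤ N_a < n. -/
/-- with `N_a, N_b ≥ 1`, `N = N_a + N_b`, `κ_1 < ⋯ < κ_N` extended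
`N`-periodically to all integers: if `1 ≤ m < n ≤ N` and
`κ_{m+N_b} + κ_m = κ_{n+N_b} + κ_n`, then `m ≤ N_a < n`. -/
theorem statement12 (Na Nb : ℕ) (hNa : 1 ≤ Na) (hNb : 1 ≤ Nb)
    (κ : ℤ → ℝ)
    (hper : ∀ k : ℤ, κ (k + (Na + Nb : ℤ)) = κ k)
    (hmono : ∀ k k' : ℤ, 1 ≤ k → k < k' → k' ≤ (Na + Nb : ℤ) → κ k < κ k')
    (m n : ℤ) (h1 : 1 ≤ m) (h2 : m < n) (h3 : n ≤ (Na + Nb : ℤ))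
    (heq : κ (m + (Nb : ℤ)) + κ m = κ (n + (Nb : ℤ)) + κ n) :
    m ≤ (Na : ℤ) ∧ (Na : ℤ) < n := by
  have hmn := hmono m n h1 h2 h3
  constructor
  · by_contra hc
    have e1 := hper (m - Na)
    have e2 := hper (n - Na)
    rw [show m - (Na : ℤ) + (Na + Nb : ℤ) = m + Nb by ring] at e1
    rw [show n - (Na : ℤ) + (Na + Nb : ℤ) = n + Nb by ring] at e2
    have := hmono (m - Na) (n - Na) (by omega) (by omega) (by omega)
    linarith
  · by_contra hc
    have := hmono (m + Nb) (n + Nb) (by omega) (by omega) (by omega)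
    linarith
end

section
/- If every maximal minor of Д is nonnegative, then the matrix d̃ is totally nonnegative, i.e. the determinant of every square submatrix of d̃ (formed by any rows and columns taken in increasing order) is nonnegative. Moreover, if every maximal minor of Д is strictly positive, then every such minor of d̃ is strictly positive. -/
open Matrix

lemma aux_last (n : ℕ) (M : Matrix (Fin (n+1)) (Fin (n+1)) ℝ) (j : Fin (n+1))
    (h : ∀ l, M (Fin.last n) l = if j = l then 1 else 0) :
    M.det = (-1)^(n+(j:ℕ)) * (M.submatrix Fin.castSucc j.succAbove).det := by
  rw [Matrix.det_succ_row M (Fin.last n), Finset.sum_eq_single j]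
  · rw [h]; simp [Fin.succAbove_last]
  · intro b _ hb
    rw [h, if_neg hb.symm]; simp
  · simp

lemma aux_det_s14 (k m : ℕ) : ∀ (A : Matrix (Fin k) (Fin (k+m)) ℝ) (c : Fin k → Fin (k+m))
    (e : Fin m → Fin (k+m)), StrictMono c → StrictMono e → (∀ a i, c a ≠ e i) →
    (Matrix.of fun (i l : Fin (k+m)) => Fin.addCases (motive := fun _ => ℝ) (fun a => A a l)
      (fun j => if e j = l then 1 else 0) i).det =
    (-1)^(∑ i : Fin m, (k + (i:ℕ) + (e i : ℕ))) * (Matrix.of fun a b => A a (c b)).det := by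
  induction m with
  | zero =>
    intro A c e hc he hce
    have : c = id := by
      refine (StrictMono.range_inj hc strictMono_id).1 ?_
      rw [Set.range_id, Set.range_eq_univ]
      exact Finite.surjective_of_injective hc.injective
    subst this
    simp
    congr 1
    ext i l
    exact Fin.addCases_left (motive := fun _ => ℝ) (m := k) (n := 0)
      (left := fun a => A a l) (right := fun j => if e j = l then 1 else 0) i
  | succ m ih =>
    intro A c e hc he hce
    set j := e (Fin.last m) with hj
    have h1 : ∀ a, ∃ b : Fin (k+m), j.succAbove b = c a := fun a =>
      Fin.exists_succAbove_eq (hce a _)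
    choose c' hc' using h1
    have hlt : ∀ i : Fin m, e i.castSucc < j := fun i => he (Fin.castSucc_lt_last i)
    have h2 : ∀ i : Fin m, ∃ b : Fin (k+m), j.succAbove b = e i.castSucc := fun i =>
      Fin.exists_succAbove_eq (hlt i).ne
    choose e' he' using h2
    have hval : ∀ i, (e' i : ℕ) = e i.castSucc := by
      intro i
      have h := he' i
      have hl := hlt i
      rw [← h] at hl ⊢
      rw [Fin.succAbove_lt_iff_castSucc_lt] at hl
      rw [Fin.succAbove_of_castSucc_lt _ _ hl]; rfl
    have key := ih (fun a l => A a (j.succAbove l)) c' e'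
      (fun a b hab => by
        have := hc hab
        rw [← hc', ← hc'] at this
        exact (Fin.strictMono_succAbove j).lt_iff_lt.1 this)
      (fun a b hab => by
        have := he (Fin.castSucc_lt_castSucc_iff.2 hab)
        rw [← he', ← he'] at this
        exact (Fin.strictMono_succAbove j).lt_iff_lt.1 this)
      (fun a i h => hce a i.castSucc (by rw [← hc', ← he', h]))
    simp only [hc'] at key
    have hlast : ∀ l, (Fin.addCases (motive := fun _ => ℝ) (fun a => A a l)
      (fun j => if e j = l then (1:ℝ) else 0) (Fin.last (k+m)) : ℝ) = if j = l then 1 else 0 := by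
      intro l
      exact Fin.addCases_right (motive := fun _ => ℝ) (m := k) (n := m+1) (Fin.last m)
    have : ((Matrix.of fun (i l : Fin (k+(m+1))) => Fin.addCases (motive := fun _ => ℝ) (fun a => A a l)
      (fun j => if e j = l then 1 else 0) i).submatrix (Fin.castSucc : Fin (k+m) → Fin (k+m+1)) j.succAbove) =
      (Matrix.of fun (i l : Fin (k+m)) => Fin.addCases (motive := fun _ => ℝ) (fun a => A a (j.succAbove l))
    (fun j => if e' j = l then 1 else 0) i) := by
      ext i l
      rw [Matrix.submatrix_apply, Matrix.of_apply, Matrix.of_apply]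
      refine Fin.addCases (fun a => ?_) (fun i => ?_) i
      · rw [Fin.addCases_left]
        exact Fin.addCases_left (motive := fun _ => ℝ) (m := k) (n := m+1) a
      · rw [Fin.addCases_right]
        refine (Fin.addCases_right (motive := fun _ => ℝ) (m := k) (n := m+1) i.castSucc).trans ?_
        rw [← he']
        simp only [(Fin.strictMono_succAbove j).injective.eq_iff]
    refine (aux_last (k+m) _ j hlast).trans ?_
    refine (congrArg (fun x => (-1:ℝ)^(k+m+(j:ℕ)) * Matrix.det x) this).trans ?_
    rw [key, Fin.sum_univ_castSucc, pow_add]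
    simp only [hval, Fin.val_castSucc, Fin.val_last, ← hj]
    ring

lemma aux_rev (k : ℕ) : ∀ (A : Matrix (Fin k) (Fin k) ℝ),
    (A.submatrix Fin.rev id).det = (-1)^(∑ i : Fin k, (i:ℕ)) * A.det := by
  induction k with
  | zero => intro A; simp
  | succ k ih =>
    intro A
    rw [Matrix.det_succ_row _ (Fin.last k), Matrix.det_succ_row A 0, Finset.mul_sum]
    refine Finset.sum_congr rfl fun j _ => ?_
    have : ((A.submatrix Fin.rev id).submatrix (Fin.last k).succAbove j.succAbove) =
      (A.submatrix (Fin.succAbove 0) j.succAbove).submatrix Fin.rev id := by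
      ext a b
      simp [Fin.rev_castSucc]
    rw [this, ih, Fin.sum_univ_castSucc]
    simp [pow_add]
    ring

lemma aux_sum (k m : ℕ) (c : Fin k → Fin (k+m))
    (e : Fin m → Fin (k+m)) (hc : StrictMono c) (he : StrictMono e) (hce : ∀ a i, c a ≠ e i) :
    (-1:ℝ)^(∑ i : Fin m, (k + (i:ℕ) + (e i : ℕ))) =
      (∏ b, (-1:ℝ)^(c b : ℕ)) * (-1)^(∑ i : Fin k, (i:ℕ)) := by
  have hb : Function.Bijective (Fin.addCases (motive := fun _ => Fin (k+m)) c e) := by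
    rw [← Finite.injective_iff_bijective]
    intro x y
    refine Fin.addCases (fun a => ?_) (fun a => ?_) x <;>
    refine Fin.addCases (fun b => ?_) (fun b => ?_) y
    · simp [hc.injective.eq_iff]
    · simp [hce]
    · simp [(hce _ _).symm]
    · simp [he.injective.eq_iff]
  have h1 := hb.sum_comp (fun x : Fin (k+m) => (x:ℕ))
  simp only [Fin.sum_univ_add, Fin.addCases_left, Fin.addCases_right, Fin.val_castAdd, Fin.val_natAdd] at h1
  rw [Finset.prod_pow_eq_pow_sum, ← pow_add, Finset.sum_add_distrib]
  generalize ∑ i : Fin m, (k + (i:ℕ)) = P at *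
  generalize ∑ i : Fin m, (e i:ℕ) = Q at *
  generalize ∑ i : Fin k, (c i:ℕ) = R at *
  generalize ∑ i : Fin k, (i:ℕ) = S at *
  refine neg_one_pow_congr ?_
  rw [Nat.even_iff, Nat.even_iff]
  omega

lemma aux_main (Na Nb : ℕ)
    (d : Matrix (Fin Na) (Fin Nb) ℝ)
    (D : Matrix (Fin (Na + Nb)) (Fin Nb) ℝ)
    (hD : ∀ (i : Fin (Na + Nb)) (l : Fin Nb),
      D i l = if h : (i : ℕ) < Na then d ⟨(i : ℕ), h⟩ l
        else (if (i : ℕ) - Na = (l : ℕ) then 1 else 0))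
    (dt : Matrix (Fin Na) (Fin Nb) ℝ)
    (hdt : ∀ (i : Fin Na) (j : Fin Nb), dt i j = (-1 : ℝ) ^ (j : ℕ) * d i.rev j)
    (k : ℕ) (r : Fin k → Fin Na) (c : Fin k → Fin Nb)
    (hr : StrictMono r) (hc : StrictMono c) :
    ∃ s : Fin Nb → Fin (Na + Nb), (∀ i j : Fin Nb, i < j → s i < s j) ∧
      (Matrix.of fun i l => D (s i) l).det = (Matrix.of fun a b => dt (r a) (c b)).det := by
  obtain ⟨m, rfl⟩ : ∃ m, Nb = k + m := by
    have := Fintype.card_le_of_injective c hc.injective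
    simp at this
    exact ⟨Nb - k, by omega⟩
  have hcard : ((Finset.univ.image c)ᶜ).card = m := by
    rw [Finset.card_compl, Finset.card_image_of_injective _ hc.injective]; simp
  set e := (Finset.univ.image c)ᶜ.orderEmbOfFin hcard
  have he : StrictMono e := e.strictMono
  have hce : ∀ a i, c a ≠ e i := by
    intro a i h
    have := Finset.orderEmbOfFin_mem _ hcard i
    change e i ∈ _ at this
    rw [← h] at this
    simp at this
  refine ⟨Fin.addCases (fun a => Fin.castAdd _ (r a.rev).rev) (fun i => Fin.natAdd Na (e i)), ?_, ?_⟩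
  · intro x y
    refine Fin.addCases (fun a => ?_) (fun a => ?_) x <;>
    refine Fin.addCases (fun b => ?_) (fun b => ?_) y
    · simp only [Fin.addCases_left]
      intro h
      have h' : b.rev < a.rev := by
        rw [Fin.rev_lt_rev]; exact h
      have := Fin.rev_lt_rev.2 (hr h')
      exact this
    · intro _
      simp only [Fin.addCases_left, Fin.addCases_right]
      rw [Fin.lt_def]
      have := (r a.rev).rev.isLt
      simp only [Fin.val_castAdd, Fin.val_natAdd]; omega
    · intro h
      rw [Fin.lt_def] at h
      simp only [Fin.val_castAdd, Fin.val_natAdd] at h; omega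
    · simp only [Fin.addCases_right]
      intro h
      have h' : a < b := by simpa using h
      simpa using he h'
  · have h1 := aux_det_s14 k m (fun a l => d (r a.rev).rev l) c e hc he hce
    have h2 : (Matrix.of fun a b => d (r a.rev).rev (c b)) =
      (Matrix.of fun a b => d (r a).rev (c b)).submatrix Fin.rev id := rfl
    have h3 : (Matrix.of fun a b => dt (r a) (c b)) =
      Matrix.of fun a b => (-1:ℝ)^(c b:ℕ) * (Matrix.of fun a b => d (r a).rev (c b)) a b := by
      ext a b; simp [hdt]
    rw [h2, aux_rev, aux_sum k m c e hc he hce] at h1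
    rw [h3, Matrix.det_mul_row]
    have hs : ((-1:ℝ)^(∑ i : Fin k, (i:ℕ))) * (-1)^(∑ i : Fin k, (i:ℕ)) = 1 := by
      rw [← mul_pow]; simp
    trans
    swap
    · refine h1.trans ?_
      linear_combination (∏ b, (-1:ℝ)^(c b : ℕ)) * (Matrix.of fun a b => d (r a).rev (c b)).det * hs
    · congr 1
      ext i l
      simp only [Matrix.of_apply]
      rw [hD]
      refine Fin.addCases (fun a => ?_) (fun i => ?_) i
      · rw [Fin.addCases_left, Fin.addCases_left, dif_pos (by exact (r a.rev).rev.isLt)]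
        rfl
      · simp [Fin.ext_iff]



/-- let `d` be a real `N_a × N_b` matrix and `Д` the `(N_a+N_b) × N_b`
matrix whose first `N_a` rows are those of `d` and whose last `N_b` rows form the
identity `E_{N_b}`.  Let `d̃` be defined by `d̃_{n,l} = (−1)^{l+1} d_{N_a+1−n, l}`
(in 1-based indexing; in 0-based indexing `d̃ i j = (−1)^j d (rev i) j`).
If every maximal minor of `Д` (determinant of the `N_b × N_b` submatrix formed by
rows `n_1 < ⋯ < n_{N_b}`) is nonnegative, then `d̃` is totally nonnegative: every
square minor of `d̃` (rows and columns in increasing order) is nonnegative.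
Moreover, if every maximal minor of `Д` is strictly positive, then every such minor
of `d̃` is strictly positive. -/
theorem statement14 (Na Nb : ℕ) (hNa : 1 ≤ Na) (hNb : 1 ≤ Nb)
    (d : Matrix (Fin Na) (Fin Nb) ℝ)
    (D : Matrix (Fin (Na + Nb)) (Fin Nb) ℝ)
    (hD : ∀ (i : Fin (Na + Nb)) (l : Fin Nb),
      D i l = if h : (i : ℕ) < Na then d ⟨(i : ℕ), h⟩ l
        else (if (i : ℕ) - Na = (l : ℕ) then 1 else 0))
    (dt : Matrix (Fin Na) (Fin Nb) ℝ)
    (hdt : ∀ (i : Fin Na) (j : Fin Nb), dt i j = (-1 : ℝ) ^ (j : ℕ) * d i.rev j) :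
    ((∀ s : Fin Nb → Fin (Na + Nb), (∀ i j : Fin Nb, i < j → s i < s j) →
        0 ≤ (Matrix.of fun i l => D (s i) l).det) →
      ∀ (k : ℕ) (r : Fin k → Fin Na) (c : Fin k → Fin Nb),
        (∀ a b : Fin k, a < b → r a < r b) → (∀ a b : Fin k, a < b → c a < c b) →
        0 ≤ (Matrix.of fun a b => dt (r a) (c b)).det) ∧
    ((∀ s : Fin Nb → Fin (Na + Nb), (∀ i j : Fin Nb, i < j → s i < s j) →
        0 < (Matrix.of fun i l => D (s i) l).det) →
      ∀ (k : ℕ) (r : Fin k → Fin Na) (c : Fin k → Fin Nb),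
        (∀ a b : Fin k, a < b → r a < r b) → (∀ a b : Fin k, a < b → c a < c b) →
        0 < (Matrix.of fun a b => dt (r a) (c b)).det) := by
  constructor
  · intro h k r c hr hc
    obtain ⟨s, hs, h1⟩ := aux_main Na Nb d D hD dt hdt k r c (fun a b => hr a b) (fun a b => hc a b)
    rw [← h1]
    exact h s hs
  · intro h k r c hr hc
    obtain ⟨s, hs, h1⟩ := aux_main Na Nb d D hD dt hdt k r c (fun a b => hr a b) (fun a b => hc a b)
    rw [← h1]
    exact h s hs
end

section
/- Assume f_{n_1,…,n_{N_b}} ≥ 0 for all 1 ≤ n_1 < ⋯ < n_{N_b} ≤ N and z_n > 0 for all n = 1,…,N (so that τ(x) > 0 for every x and the potential u is well defined). Then for every integer n and every sequence (x_j) in ℝ² tending to infinity along the ray r_n, the difference u(x_j) − v_n(x_j) converges to 0, where v_n(x) = −2 ∂²_{x_1} log( z_n + z_{n+1} e^{K_{n+N_b}(x) − K_n(x)} ). -/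
noncomputable section

open Filter Matrix

/-- The potential `u(x) = −2 ∂²_{x₁} log τ(x)`. -/
def upot (Na Nb : ℕ) (κ : ℤ → ℝ) (D : Matrix (Fin (Na + Nb)) (Fin Nb) ℝ)
    (x : ℝ × ℝ) : ℝ :=
  -2 * deriv (deriv (fun y : ℝ => Real.log (tauf Na Nb κ D (y, x.2)))) x.1

/-- The one-soliton-like asymptotic potential along the ray `r_n`:
`v_n(x) = −2 ∂²_{x₁} log ( z_n + z_{n+1} e^{K_{n+N_b}(x) − K_n(x)} )`. -/
def vpot (Na Nb : ℕ) (hN : 0 < Na + Nb) (κ : ℤ → ℝ)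
    (D : Matrix (Fin (Na + Nb)) (Fin Nb) ℝ) (n : ℤ) (x : ℝ × ℝ) : ℝ :=
  -2 * deriv (deriv (fun y : ℝ => Real.log
      (zc Na Nb hN κ D n + zc Na Nb hN κ D (n + 1) *
        Real.exp (Kf κ (n + (Nb : ℤ)) (y, x.2) - Kf κ n (y, x.2))))) x.1

/-- multilinear coefficient -/
def cco (Nb N : ℕ) (v : Fin N → ℝ) (D : Matrix (Fin N) (Fin Nb) ℝ) (p : Fin Nb → Fin N) : ℝ :=
  (∏ i, v (p i) ^ (i : ℕ)) * (Matrix.of (fun i l => D (p i) l)).det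

/-- full coefficient -/
def fco (Nb N : ℕ) (v : Fin N → ℝ) (D : Matrix (Fin N) (Fin Nb) ℝ) (p : Fin Nb → Fin N) : ℝ :=
  (Matrix.vandermonde (fun i => v (p i))).det * (Matrix.of (fun i l => D (p i) l)).det

lemma det_expand (Nb N : ℕ) (v e : Fin N → ℝ) (D : Matrix (Fin N) (Fin Nb) ℝ) :
    (Matrix.of (fun (i : Fin Nb) (n : Fin N) => v n ^ (i : ℕ)) * Matrix.diagonal e * D).det
      = ∑ p : Fin Nb → Fin N, cco Nb N v D p * ∏ i, e (p i) := by
  have h : (Matrix.of (fun (i : Fin Nb) (n : Fin N) => v n ^ (i : ℕ)) * Matrix.diagonal e * D)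
      = fun (i : Fin Nb) => ∑ k : Fin N, (v k ^ (i : ℕ) * e k) • D k := by
    ext i l
    rw [Matrix.mul_apply]
    simp [Finset.sum_apply, Matrix.mul_diagonal]
  rw [h]
  change (Matrix.detRowAlternating (R := ℝ) (n := Fin Nb)).toMultilinearMap _ = _
  rw [MultilinearMap.map_sum]
  refine Finset.sum_congr rfl fun p _ => ?_
  rw [MultilinearMap.map_smul_univ, Finset.prod_mul_distrib]
  unfold cco
  change (_ * _) * Matrix.det (Matrix.of (fun i l => D (p i) l)) = _
  ring

lemma cco_perm (Nb N : ℕ) (v : Fin N → ℝ) (D : Matrix (Fin N) (Fin Nb) ℝ) (q : Fin Nb → Fin N) :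
    ∑ σ : Equiv.Perm (Fin Nb), cco Nb N v D (q ∘ σ) = fco Nb N v D q := by
  unfold fco
  rw [Matrix.det_apply', Finset.sum_mul]
  refine Finset.sum_congr rfl fun σ _ => ?_
  have := Matrix.det_permute σ (Matrix.of (fun i l => D (q i) l))
  have h2 : (Matrix.of (fun i l => D ((q ∘ σ) i) l)) = (Matrix.of (fun i l => D (q i) l)).submatrix σ id := by
    ext i l; simp
  unfold cco
  rw [h2, this]
  simp only [Matrix.vandermonde_apply, Function.comp]
  ring

lemma cco_inj (Nb N : ℕ) (v : Fin N → ℝ) (D : Matrix (Fin N) (Fin Nb) ℝ) (p : Fin Nb → Fin N)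
    (h : cco Nb N v D p ≠ 0) : Function.Injective p := by
  intro i j hij
  by_contra hne
  apply h
  unfold cco
  rw [Matrix.det_zero_of_row_eq hne, mul_zero]
  ext l; simp [hij]

/-- remaining index functions -/
def restS (Nb N : ℕ) (p0 p1 : Fin Nb → Fin N) : Finset (Fin Nb → Fin N) :=
  open Classical in
  Finset.univ.filter (fun p => (¬ ∃ σ : Equiv.Perm (Fin Nb), p0 ∘ σ = p) ∧
    (¬ ∃ σ : Equiv.Perm (Fin Nb), p1 ∘ σ = p))

lemma sum_split (Nb N : ℕ) (v : Fin N → ℝ) (D : Matrix (Fin N) (Fin Nb) ℝ)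
    (p0 p1 : Fin Nb → Fin N) (h0 : Function.Injective p0) (h1 : Function.Injective p1)
    (h01 : ∀ σ : Equiv.Perm (Fin Nb), p0 ∘ σ ≠ p1)
    (G : (Fin Nb → Fin N) → ℝ) (hG : ∀ p, ∀ σ : Equiv.Perm (Fin Nb), G (p ∘ σ) = G p) :
    ∑ p, cco Nb N v D p * G p = fco Nb N v D p0 * G p0 + fco Nb N v D p1 * G p1
      + ∑ p ∈ restS Nb N p0 p1, cco Nb N v D p * G p := by
  classical
  have key : ∀ q : Fin Nb → Fin N, Function.Injective q →
      ∑ p ∈ Finset.univ.filter (fun p => ∃ σ : Equiv.Perm (Fin Nb), q ∘ σ = p),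
        cco Nb N v D p * G p = fco Nb N v D q * G q := by
    intro q hq
    have : Finset.univ.filter (fun p => ∃ σ : Equiv.Perm (Fin Nb), q ∘ σ = p)
      = Finset.univ.image (fun σ : Equiv.Perm (Fin Nb) => q ∘ σ) := by
      ext p; simp
    rw [this, Finset.sum_image, ← cco_perm, Finset.sum_mul]
    · exact Finset.sum_congr rfl fun σ _ => by rw [hG]
    · intro σ _ τ _ h
      ext i
      have := congrFun h i
      simpa using congrArg Fin.val (hq this)
  rw [← key p0 h0, ← key p1 h1,
    ← Finset.sum_filter_add_sum_filter_not Finset.univ (fun p => ∃ σ : Equiv.Perm (Fin Nb), p0 ∘ σ = p),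
    add_assoc]
  congr 1
  rw [← Finset.sum_filter_add_sum_filter_not (Finset.univ.filter fun p => ¬ ∃ σ : Equiv.Perm (Fin Nb), p0 ∘ σ = p)
    (fun p => ∃ σ : Equiv.Perm (Fin Nb), p1 ∘ σ = p)]
  congr 1
  · refine Finset.sum_congr ?_ fun _ _ => rfl
    ext p
    simp only [Finset.mem_filter, Finset.mem_univ, true_and, and_iff_right_iff_imp]
    rintro ⟨σ, rfl⟩ ⟨τ, h⟩
    apply h01 (σ⁻¹.trans τ)
    ext i
    have := congrFun h (σ⁻¹ i)
    simp at this
    simp [this]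
  · refine Finset.sum_congr ?_ fun _ _ => rfl
    ext p
    simp [restS]

lemma deriv2_log (F g g1 g2 : ℝ → ℝ) (l l2 y0 : ℝ)
    (hF : ∀ y, F y = Real.exp (l * y + l2) * g y)
    (h1 : ∀ y, HasDerivAt g (g1 y) y) (h2 : ∀ y, HasDerivAt g1 (g2 y) y) (h0 : g y0 ≠ 0) :
    deriv (deriv (fun y => Real.log (F y))) y0 = g2 y0 / g y0 - (g1 y0 / g y0) ^ 2 := by
  have hne : ∀ᶠ y in nhds y0, g y ≠ 0 := (h1 y0).continuousAt.eventually_ne h0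
  have e1 : deriv (fun y => Real.log (F y)) =ᶠ[nhds y0] fun y => l + g1 y / g y := by
    filter_upwards [hne.eventually_nhds] with y hy
    have : (fun y => Real.log (F y)) =ᶠ[nhds y] fun y => (l * y + l2) + Real.log (g y) := by
      filter_upwards [hy] with w hw
      rw [hF, Real.log_mul (Real.exp_ne_zero _) hw, Real.log_exp]
    rw [this.deriv_eq]
    have hl : HasDerivAt (fun y => l * y + l2) l y := by
      simpa using ((hasDerivAt_id y).const_mul l).add_const l2
    exact (hl.add ((h1 y).log hy.self_of_nhds)).deriv
  rw [e1.deriv_eq]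
  have := (((h2 y0).div (h1 y0) h0).const_add l).deriv
  refine Eq.trans this ?_
  field_simp

lemma ratio_lim (A R0 Ak Rk : ℕ → ℝ) (z B : ℝ) (hz : 0 < z) (hA : ∀ j, z ≤ A j)
    (hB : ∀ j, |Ak j / A j| ≤ B) (h0 : Tendsto R0 atTop (nhds 0)) (hk : Tendsto Rk atTop (nhds 0)) :
    Tendsto (fun j => (Ak j + Rk j) / (A j + R0 j) - Ak j / A j) atTop (nhds 0) := by
  have ev : ∀ᶠ j in atTop, |R0 j| < z / 2 := by
    have := h0.abs
    simp only [abs_zero] at this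
    exact this.eventually (gt_mem_nhds (by positivity))
  have lim : Tendsto (fun j => (|Rk j| + B * |R0 j|) / (z / 2)) atTop (nhds 0) := by
    have := (hk.abs.add (h0.abs.const_mul B)).div_const (z / 2)
    simpa using this
  apply squeeze_zero_norm' _ lim
  filter_upwards [ev] with j hj
  have hAj := hA j
  have hlt := abs_lt.1 hj
  have hpos : z / 2 ≤ A j + R0 j := by linarith [hlt.1]
  have hA0 : 0 < A j := by linarith
  have hS : 0 < A j + R0 j := by linarith
  have e : (Ak j + Rk j) / (A j + R0 j) - Ak j / A j
      = (Rk j - (Ak j / A j) * R0 j) / (A j + R0 j) := by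
    field_simp; ring
  rw [e, Real.norm_eq_abs, abs_div, abs_of_pos hS]
  have : |Rk j - (Ak j / A j) * R0 j| ≤ |Rk j| + B * |R0 j| := by
    refine (abs_sub _ _).trans ?_
    rw [abs_mul]
    gcongr
    exact hB j
  exact div_le_div₀ ((abs_nonneg _).trans this) this (by positivity) hpos

lemma sq_lim (r s : ℕ → ℝ) (B : ℝ) (hs : ∀ j, |s j| ≤ B)
    (h : Tendsto (fun j => r j - s j) atTop (nhds 0)) :
    Tendsto (fun j => r j ^ 2 - s j ^ 2) atTop (nhds 0) := by
  have l2 : Tendsto (fun j => |r j - s j| ^ 2 + 2 * B * |r j - s j|) atTop (nhds 0) := by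
    have := (h.abs.pow 2).add (h.abs.const_mul (2 * B))
    simpa using this
  apply squeeze_zero_norm _ l2
  intro j
  have : r j ^ 2 - s j ^ 2 = (r j - s j) ^ 2 + 2 * s j * (r j - s j) := by ring
  rw [this, Real.norm_eq_abs]
  refine (abs_add_le _ _).trans ?_
  rw [abs_mul, abs_mul, abs_pow]
  have := hs j
  gcongr
  simp

lemma sum_lt_aux {N : ℕ} (φ : Fin N → ℝ) (M S : Finset (Fin N)) (a b : Fin N)
    (haM : a ∉ M) (hbM : b ∉ M)
    (hcard : S.card = M.card + 1)
    (hpos : ∀ k ∈ M, 0 < φ k)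
    (hneg : ∀ k, k ∉ M → k ≠ a → k ≠ b → φ k < 0) (ha : φ a = 0) (hb : φ b = 0)
    (hSa : S ≠ insert a M) (hSb : S ≠ insert b M) :
    ∑ k ∈ S, φ k < ∑ k ∈ M, φ k := by
  classical
  by_cases hMS : M ⊆ S
  · have h1 : (S \ M).card = 1 := by
      rw [Finset.card_sdiff_of_subset hMS]; omega
    obtain ⟨c, hc⟩ := Finset.card_eq_one.1 h1
    have hS : S = insert c M := by
      rw [← Finset.sdiff_union_of_subset hMS, hc]; rfl
    have hcM : c ∉ M := by
      have : c ∈ S \ M := by simp [hc]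
      exact (Finset.mem_sdiff.1 this).2
    have hca : c ≠ a := by rintro rfl; exact hSa hS
    have hcb : c ≠ b := by rintro rfl; exact hSb hS
    rw [hS, Finset.sum_insert hcM]
    linarith [hneg c hcM hca hcb]
  · obtain ⟨m, hmM, hmS⟩ := Finset.not_subset.1 hMS
    have h1 : ∑ k ∈ S, φ k ≤ ∑ k ∈ S ∩ M, φ k := by
      rw [← Finset.sum_inter_add_sum_sdiff S M φ]
      have : ∑ k ∈ S \ M, φ k ≤ 0 := by
        apply Finset.sum_nonpos
        intro k hk
        have hk := (Finset.mem_sdiff.1 hk).2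
        by_cases h : k = a
        · rw [h, ha]
        by_cases h' : k = b
        · rw [h', hb]
        exact (hneg k hk h h').le
      linarith
    refine h1.trans_lt ?_
    apply Finset.sum_lt_sum_of_subset Finset.inter_subset_right hmM (by simp [hmS]) (hpos m hmM)
    intro k hk _
    exact (hpos k hk).le

lemma perm_of_image {N Nb : ℕ} (p q : Fin Nb → Fin N) (hp : Function.Injective p)
    (h : Finset.univ.image p = Finset.univ.image q) :
    ∃ σ : Equiv.Perm (Fin Nb), q ∘ σ = p := by
  have h1 : ∀ i, ∃ j, q j = p i := by
    intro i
    have : p i ∈ Finset.univ.image q := by rw [← h]; simp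
    simpa using this
  choose f hf using h1
  have hinj : Function.Injective f := by
    intro i j hij
    apply hp
    rw [← hf, ← hf, hij]
  refine ⟨Equiv.ofBijective f (Finite.injective_iff_bijective.1 hinj), ?_⟩
  ext i
  simp [hf]

lemma kper (N : ℤ) (κ : ℤ → ℝ) (hper : ∀ k : ℤ, κ (k + N) = κ k) (k q : ℤ) :
    κ (k + N * q) = κ k := by
  have h : Function.Periodic κ N := hper
  have := h.int_mul q k
  rw [mul_comm]
  exact this

lemma kmod (N : ℤ) (κ : ℤ → ℝ) (hper : ∀ k : ℤ, κ (k + N) = κ k) (n : ℤ) :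
    κ ((n - 1) % N + 1) = κ n := by
  rw [← kper N κ hper _ ((n - 1) / N)]
  congr 1
  have := Int.emod_add_mul_ediv (n - 1) N
  linarith

lemma kidx (N : ℕ) (hN : 0 < N) (κ : ℤ → ℝ) (hper : ∀ k : ℤ, κ (k + N) = κ k) (n : ℤ) :
    κ (((idx N hN n : Fin N) : ℕ) + 1) = κ n := by
  rw [← kmod N κ hper n]
  congr 2
  simp only [idx]
  exact Int.toNat_of_nonneg (Int.emod_nonneg _ (by exact_mod_cast hN.ne'))

lemma idx_eq (N : ℕ) (hN : 0 < N) (m n : ℤ) :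
    idx N hN m = idx N hN n ↔ (N : ℤ) ∣ m - n := by
  have h1 := Int.emod_nonneg (m - 1) (by exact_mod_cast hN.ne' : (N : ℤ) ≠ 0)
  have h2 := Int.emod_nonneg (n - 1) (by exact_mod_cast hN.ne' : (N : ℤ) ≠ 0)
  simp only [idx, Fin.mk.injEq]
  have : (N : ℤ) ∣ m - n ↔ (m - 1) % N = (n - 1) % N := by
    rw [Int.emod_eq_emod_iff_emod_sub_eq_zero, ← Int.dvd_iff_emod_eq_zero]
    congr! 1; ring
  rw [this]
  omega

lemma idx_inj (N : ℕ) (hN : 0 < N) (n : ℤ) (s t : ℕ) (hs : s < N) (ht : t < N)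
    (h : idx N hN (n + s) = idx N hN (n + t)) : s = t := by
  rw [idx_eq] at h
  have h' : (N : ℤ) ∣ (s : ℤ) - t := by convert h using 1; ring
  have := Int.eq_zero_of_abs_lt_dvd h' (by rw [abs_lt]; constructor <;> omega)
  omega

lemma idx_surj (N : ℕ) (hN : 0 < N) (n : ℤ) (k : Fin N) :
    ∃ t : ℕ, t < N ∧ idx N hN (n + t) = k := by
  have hk : idx N hN ((k : ℕ) + 1) = k := by
    ext
    simp only [idx, add_sub_cancel_right]
    rw [Int.emod_eq_of_lt (by omega) (by have := k.2; omega)]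
    simp
  have h0 : (N : ℤ) ≠ 0 := by omega
  have h1 := Int.emod_nonneg ((k : ℕ) + 1 - n : ℤ) h0
  have h2 := Int.emod_lt_of_pos ((k : ℕ) + 1 - n : ℤ) (by omega : (0 : ℤ) < N)
  refine ⟨(((k : ℕ) + 1 - n : ℤ) % N).toNat, by omega, ?_⟩
  conv_rhs => rw [← hk]
  rw [idx_eq, Int.toNat_of_nonneg h1]
  have := Int.emod_add_mul_ediv ((k : ℕ) + 1 - n : ℤ) N
  refine ⟨-(((k : ℕ) + 1 - n : ℤ) / N), ?_⟩
  linarith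

lemma sign_lem (Na Nb : ℕ) (hNa : 0 < Na) (hNb : 0 < Nb) (κ : ℤ → ℝ)
    (hper : ∀ k : ℤ, κ (k + (Na + Nb : ℤ)) = κ k)
    (hmono : ∀ k k' : ℤ, 1 ≤ k → k < k' → k' ≤ (Na + Nb : ℤ) → κ k < κ k')
    (n : ℤ) (t : ℤ) (h0 : 0 < t) (hN : t < Na + Nb) :
    (t < Nb → (κ (n + Nb) - κ n) * (κ (n + t) - κ n) * (κ (n + t) - κ (n + Nb)) < 0) ∧
    (Nb < t → 0 < (κ (n + Nb) - κ n) * (κ (n + t) - κ n) * (κ (n + t) - κ (n + Nb))) := by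
  obtain ⟨m, hm1, hm2, hm⟩ : ∃ m : ℤ, 1 ≤ m ∧ m ≤ Na + Nb ∧ ∀ s, κ (n + s) = κ (m + s) := by
    have h1 := Int.emod_nonneg (n - 1) (by omega : (Na + Nb : ℤ) ≠ 0)
    have h2 := Int.emod_lt_of_pos (n - 1) (by omega : (0 : ℤ) < Na + Nb)
    refine ⟨(n - 1) % (Na + Nb) + 1, by omega, by omega, fun s => ?_⟩
    rw [← kper _ κ hper (_ + 1 + s) ((n - 1) / (Na + Nb))]
    congr 1
    have := Int.emod_add_mul_ediv (n - 1) (Na + Nb)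
    linarith
  have hm0 : κ n = κ m := by simpa using hm 0
  have hr : ∀ s : ℤ, m + s > Na + Nb → κ (m + s) = κ (m + s - (Na + Nb)) := by
    intro s _
    rw [← hper (m + s - (Na + Nb))]; congr 1; ring
  rw [hm, hm, hm0]
  by_cases c1 : m + t ≤ Na + Nb <;> by_cases c2 : m + Nb ≤ Na + Nb
  · have i1 := hmono m (m + t) hm1 (by omega) c1
    have i2 := hmono m (m + Nb) hm1 (by omega) c2
    refine ⟨fun h => ?_, fun h => ?_⟩
    · have i3 := hmono (m + t) (m + Nb) (by omega) (by omega) c2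
      exact mul_neg_of_pos_of_neg (mul_pos (by linarith) (by linarith)) (by linarith)
    · have i3 := hmono (m + Nb) (m + t) (by omega) (by omega) c1
      exact mul_pos (mul_pos (by linarith) (by linarith)) (by linarith)
  · rw [hr Nb (by omega)]
    have i1 := hmono m (m + t) hm1 (by omega) c1
    have i2 := hmono (m + Nb - (Na + Nb)) m (by omega) (by omega) hm2
    refine ⟨fun h => ?_, fun h => by omega⟩
    exact mul_neg_of_neg_of_pos (mul_neg_of_neg_of_pos (by linarith) (by linarith)) (by linarith)
  · rw [hr t (by omega)]
    have i1 := hmono (m + t - (Na + Nb)) m (by omega) (by omega) hm2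
    have i2 := hmono m (m + Nb) hm1 (by omega) c2
    refine ⟨fun h => by omega, fun h => ?_⟩
    exact mul_pos_of_neg_of_neg (mul_neg_of_pos_of_neg (by linarith) (by linarith)) (by linarith)
  · rw [hr t (by omega), hr Nb (by omega)]
    have i1 := hmono (m + t - (Na + Nb)) m (by omega) (by omega) hm2
    have i2 := hmono (m + Nb - (Na + Nb)) m (by omega) (by omega) hm2
    refine ⟨fun h => ?_, fun h => ?_⟩
    · have i3 := hmono (m + t - (Na + Nb)) (m + Nb - (Na + Nb)) (by omega) (by omega) (by omega)
      exact mul_neg_of_pos_of_neg (mul_pos_of_neg_of_neg (by linarith) (by linarith)) (by linarith)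
    · have i3 := hmono (m + Nb - (Na + Nb)) (m + t - (Na + Nb)) (by omega) (by omega) (by omega)
      exact mul_pos (mul_pos_of_neg_of_neg (by linarith) (by linarith)) (by linarith)

/-- cyclic window -/
def pw (Nb N : ℕ) (hN : 0 < N) (n : ℤ) : Fin Nb → Fin N := fun i => idx N hN (n + (i : ℕ))

lemma pw_inj (Nb N : ℕ) (hN : 0 < N) (h : Nb ≤ N) (n : ℤ) : Function.Injective (pw Nb N hN n) := by
  intro i j hij
  have := i.2
  have := j.2
  exact Fin.ext (idx_inj N hN n i j (by omega) (by omega) hij)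

lemma fcoef_eq (Na Nb : ℕ) (hN : 0 < Na + Nb) (κ : ℤ → ℝ)
    (hper : ∀ k : ℤ, κ (k + (Na + Nb : ℤ)) = κ k)
    (D : Matrix (Fin (Na + Nb)) (Fin Nb) ℝ) (n : ℤ) :
    zc Na Nb hN κ D n
      = fco Nb (Na + Nb) (fun k => κ ((k : ℕ) + 1)) D (pw Nb (Na + Nb) hN n) := by
  have hper' : ∀ k : ℤ, κ (k + ((Na + Nb : ℕ) : ℤ)) = κ k := by
    intro k; rw [← hper k]; push_cast; rfl
  unfold zc fcoef fco pw
  congr 1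
  rw [Matrix.det_vandermonde, Finset.prod_filter, ← Finset.univ_product_univ, Finset.prod_product]
  refine Finset.prod_congr rfl fun i _ => ?_
  simp only [kidx _ _ _ hper']
  rw [← Finset.prod_filter]
  refine Finset.prod_congr ?_ fun _ _ => rfl
  ext j; simp

lemma zc_pos (Na Nb : ℕ) (hN : 0 < Na + Nb) (κ : ℤ → ℝ)
    (hper : ∀ k : ℤ, κ (k + (Na + Nb : ℤ)) = κ k)
    (D : Matrix (Fin (Na + Nb)) (Fin Nb) ℝ)
    (hz : ∀ k : ℤ, 1 ≤ k → k ≤ (Na + Nb : ℤ) → 0 < zc Na Nb hN κ D k) (n : ℤ) :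
    0 < zc Na Nb hN κ D n := by
  have h0 : ((Na + Nb : ℕ) : ℤ) ≠ 0 := by omega
  have h1 := Int.emod_nonneg (n - 1) h0
  have h2 := Int.emod_lt_of_pos (n - 1) (by omega : (0 : ℤ) < ((Na + Nb : ℕ) : ℤ))
  have := hz ((n - 1) % ((Na + Nb : ℕ) : ℤ) + 1) (by omega) (by push_cast at *; omega)
  convert this using 1
  rw [fcoef_eq _ _ _ _ hper, fcoef_eq _ _ _ _ hper]
  congr 1
  ext i : 1
  unfold pw
  rw [idx_eq]
  have := Int.emod_add_mul_ediv (n - 1) ((Na + Nb : ℕ) : ℤ)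
  refine ⟨(n - 1) / ((Na + Nb : ℕ) : ℤ), ?_⟩
  linarith

lemma pw_ne (Na Nb : ℕ) (hNa : 0 < Na) (hNb : 0 < Nb) (hN : 0 < Na + Nb) (n : ℤ)
    (σ : Equiv.Perm (Fin Nb)) :
    pw Nb (Na + Nb) hN n ∘ σ ≠ pw Nb (Na + Nb) hN (n + 1) := by
  intro h
  have h1 := congrFun h (σ⁻¹ ⟨0, hNb⟩)
  rw [Function.comp, show σ (σ⁻¹ ⟨0, hNb⟩) = ⟨0, hNb⟩ by simp] at h1
  simp only [pw] at h1
  have h3 := (σ⁻¹ ⟨0, hNb⟩).2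
  have e : n + 1 + (((σ⁻¹ ⟨0, hNb⟩ : Fin Nb) : ℕ) : ℤ)
    = n + ((1 + ((σ⁻¹ ⟨0, hNb⟩ : Fin Nb) : ℕ) : ℕ) : ℤ) := by push_cast; ring
  rw [e] at h1
  have := idx_inj (Na + Nb) hN n 0 _ (by omega) (by omega) h1
  omega

lemma sum_pw (Nb N : ℕ) (hN : 0 < N) (n : ℤ) (h : Fin N → ℝ) :
    ∑ i, h (pw Nb N hN (n + 1) i) - ∑ i, h (pw Nb N hN n i)
      = h (idx N hN (n + Nb)) - h (idx N hN n) := by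
  unfold pw
  rw [← Finset.sum_sub_distrib]
  have := Finset.sum_range_sub (fun t : ℕ => h (idx N hN (n + t))) Nb
  rw [Finset.sum_range] at this
  simp only [Nat.cast_zero, add_zero] at this
  rw [← this]
  refine Finset.sum_congr rfl fun i _ => ?_
  congr 3
  push_cast; ring

lemma rest_lt (Na Nb : ℕ) (hNa : 0 < Na) (hNb : 0 < Nb) (hN : 0 < Na + Nb) (κ : ℤ → ℝ)
    (hper : ∀ k : ℤ, κ (k + (Na + Nb : ℤ)) = κ k)
    (hmono : ∀ k k' : ℤ, 1 ≤ k → k < k' → k' ≤ (Na + Nb : ℤ) → κ k < κ k')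
    (n : ℤ) (p : Fin Nb → Fin (Na + Nb)) (hp : Function.Injective p)
    (hr : p ∈ restS Nb (Na + Nb) (pw Nb (Na + Nb) hN n) (pw Nb (Na + Nb) hN (n + 1)))
    (φ : Fin (Na + Nb) → ℝ)
    (hφ : ∀ k : Fin (Na + Nb), φ k = -((κ (n + Nb) - κ n) * (κ ((k : ℕ) + 1) - κ n)
        * (κ ((k : ℕ) + 1) - κ (n + Nb)))) :
    ∑ i, φ (p i) < ∑ i, φ (pw Nb (Na + Nb) hN n i) := by
  classical
  have hper' : ∀ k : ℤ, κ (k + ((Na + Nb : ℕ) : ℤ)) = κ k := by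
    intro k; rw [← hper k]; push_cast; rfl
  have hP : ∀ m : ℤ, φ (idx (Na + Nb) hN m) = -((κ (n + Nb) - κ n) * (κ m - κ n)
        * (κ m - κ (n + Nb))) := by
    intro m; rw [hφ, kidx _ _ _ hper']
  set P : ℕ → Fin (Na + Nb) := fun t => idx (Na + Nb) hN (n + t) with hPdef
  have Pinj : ∀ s t, s < Na + Nb → t < Na + Nb → P s = P t → s = t :=
    fun s t hs ht h => idx_inj _ hN n s t hs ht h
  set M := (Finset.Ioo 0 Nb).image P with hM
  have memM : ∀ t, t < Na + Nb → (P t ∈ M ↔ 0 < t ∧ t < Nb) := by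
    intro t ht
    rw [hM, Finset.mem_image]
    constructor
    · rintro ⟨s, hs, hst⟩
      rw [Finset.mem_Ioo] at hs
      have := Pinj s t (by omega) ht hst
      omega
    · intro h
      exact ⟨t, by simpa using h, rfl⟩
  have hcM : M.card = Nb - 1 := by
    rw [hM, Finset.card_image_of_injOn]
    · simp
    · intro s hs t ht h
      simp at hs ht
      exact Pinj s t (by omega) (by omega) h
  have im0 : Finset.univ.image (pw Nb (Na + Nb) hN n) = insert (P 0) M := by
    ext k
    simp only [Finset.mem_image, Finset.mem_univ, true_and, Finset.mem_insert, hM, Finset.mem_Ioo]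
    constructor
    · rintro ⟨i, rfl⟩
      rcases Nat.eq_zero_or_pos (i : ℕ) with h | h
      · left; simp [pw, hPdef, h]
      · right; exact ⟨i, ⟨h, i.2⟩, rfl⟩
    · rintro (rfl | ⟨t, ht, rfl⟩)
      · exact ⟨⟨0, hNb⟩, rfl⟩
      · exact ⟨⟨t, ht.2⟩, rfl⟩
  have im1 : Finset.univ.image (pw Nb (Na + Nb) hN (n + 1)) = insert (P Nb) M := by
    ext k
    have e : ∀ t : ℕ, n + 1 + (t : ℤ) = n + ((t + 1 : ℕ) : ℤ) := by intro t; push_cast; ring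
    simp only [Finset.mem_image, Finset.mem_univ, true_and, Finset.mem_insert, hM, Finset.mem_Ioo,
      pw, e]
    constructor
    · rintro ⟨i, rfl⟩
      have := i.2
      rcases Nat.lt_or_ge ((i : ℕ) + 1) Nb with h | h
      · right; exact ⟨i + 1, ⟨by omega, h⟩, rfl⟩
      · left
        have : (i : ℕ) + 1 = Nb := by omega
        simp only [hPdef, this]
    · rintro (rfl | ⟨t, ht, rfl⟩)
      · refine ⟨⟨Nb - 1, by omega⟩, ?_⟩
        have : Nb - 1 + 1 = Nb := by omega
        simp only [hPdef, this]
      · refine ⟨⟨t - 1, by omega⟩, ?_⟩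
        have : t - 1 + 1 = t := by omega
        simp only [hPdef, this]
  have hr' := hr
  simp only [restS, Finset.mem_filter, Finset.mem_univ, true_and] at hr'
  have φ0 : φ (P 0) = 0 := by simp [hPdef, hP]
  have φb : φ (P Nb) = 0 := by simp [hPdef, hP]
  have hP0 : P 0 ∉ M := by rw [memM 0 (by omega)]; omega
  have hPb : P Nb ∉ M := by rw [memM Nb (by omega)]; omega
  have main := sum_lt_aux φ M (Finset.univ.image p) (P 0) (P Nb) hP0 hPb
    (by rw [Finset.card_image_of_injective _ hp, hcM]; simp; omega)
    (by
      intro k hk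
      obtain ⟨t, ht, rfl⟩ := Finset.mem_image.1 hk
      rw [Finset.mem_Ioo] at ht
      have := (sign_lem Na Nb hNa hNb κ hper hmono n t (by omega) (by omega)).1 (by omega)
      rw [hP]; linarith)
    (by
      intro k hk h0 hb
      obtain ⟨t, ht, rfl⟩ := idx_surj (Na + Nb) hN n k
      have h1 : t ≠ 0 := by rintro rfl; exact h0 rfl
      have h2 : t ≠ Nb := by rintro rfl; exact hb rfl
      have h3 := (memM t ht).not.1 hk
      have := (sign_lem Na Nb hNa hNb κ hper hmono n t (by omega) (by omega)).2 (by omega)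
      rw [hP]; linarith) φ0 φb
    (by
      intro h
      rw [← im0] at h
      exact hr'.1 (perm_of_image _ _ hp h))
    (by
      intro h
      rw [← im1] at h
      exact hr'.2 (perm_of_image _ _ hp h))
  rw [Finset.sum_image (fun _ _ _ _ h => hp h)] at main
  have e0 : ∑ i, φ (pw Nb (Na + Nb) hN n i) = ∑ k ∈ M, φ k := by
    rw [← Finset.sum_image (f := φ) (fun _ _ _ _ h => pw_inj Nb (Na + Nb) hN (by omega) n h), im0,
      Finset.sum_insert hP0, φ0, zero_add]
  rw [e0]; exact main

lemma exp_lim (κ : ℤ → ℝ) (Nb : ℕ) (n : ℤ) (x : ℕ → ℝ × ℝ) (hx : AlongRay κ Nb n x)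
    (a b : ℝ) (h : a * (yv κ Nb n).1 + b * (yv κ Nb n).2 < 0) :
    Tendsto (fun j => Real.exp (a * (x j).1 + b * (x j).2)) atTop (nhds 0) := by
  obtain ⟨α, hα, C, hC⟩ := hx
  apply Real.tendsto_exp_atBot.comp
  set c := a * (yv κ Nb n).1 + b * (yv κ Nb n).2 with hc
  have h1 : Tendsto (fun j => c * α j + (|a| * C + |b| * C)) atTop atBot :=
    tendsto_atBot_add_const_right _ _ (hα.const_mul_atTop_of_neg h)
  refine tendsto_atBot_mono (fun j => ?_) h1
  have hj := hC j
  have n1 := (norm_fst_le (x j - α j • yv κ Nb n)).trans hj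
  have n2 := (norm_snd_le (x j - α j • yv κ Nb n)).trans hj
  simp only [Prod.fst_sub, Prod.snd_sub, Prod.smul_fst, Prod.smul_snd, smul_eq_mul,
    Real.norm_eq_abs] at n1 n2
  have e : a * (x j).1 + b * (x j).2 = c * α j + (a * ((x j).1 - α j * (yv κ Nb n).1)
      + b * ((x j).2 - α j * (yv κ Nb n).2)) := by rw [hc]; ring
  rw [e]
  have b1 : a * ((x j).1 - α j * (yv κ Nb n).1) ≤ |a| * C := by
    refine (le_abs_self _).trans ?_
    rw [abs_mul]; gcongr
  have b2 : b * ((x j).2 - α j * (yv κ Nb n).2) ≤ |b| * C := by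
    refine (le_abs_self _).trans ?_
    rw [abs_mul]; gcongr
  linarith

lemma main_aux (Na Nb : ℕ) (hNa : 0 < Na) (hNb : 0 < Nb) (hN : 0 < Na + Nb)
    (κ : ℤ → ℝ)
    (hper : ∀ k : ℤ, κ (k + (Na + Nb : ℤ)) = κ k)
    (hmono : ∀ k k' : ℤ, 1 ≤ k → k < k' → k' ≤ (Na + Nb : ℤ) → κ k < κ k')
    (D : Matrix (Fin (Na + Nb)) (Fin Nb) ℝ)
    (hz : ∀ k : ℤ, 1 ≤ k → k ≤ (Na + Nb : ℤ) → 0 < zc Na Nb hN κ D k)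
    (n : ℤ) (x : ℕ → ℝ × ℝ) (hx : AlongRay κ Nb n x) :
    Filter.Tendsto (fun j => upot Na Nb κ D (x j) - vpot Na Nb hN κ D n (x j))
      atTop (nhds 0) := by
  have hper' : ∀ k : ℤ, κ (k + ((Na + Nb : ℕ) : ℤ)) = κ k := by
    intro k; rw [← hper k]; push_cast; rfl
  have hz0 := zc_pos Na Nb hN κ hper D hz n
  have hz1 := zc_pos Na Nb hN κ hper D hz (n + 1)
  have ez0 := fcoef_eq Na Nb hN κ hper D n
  have ez1 := fcoef_eq Na Nb hN κ hper D (n + 1)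
  unfold upot vpot
  set z0 := zc Na Nb hN κ D n
  set z1 := zc Na Nb hN κ D (n + 1)
  set v : Fin (Na + Nb) → ℝ := fun k => κ ((k : ℕ) + 1) with hv
  set p0 := pw Nb (Na + Nb) hN n with hp0
  set p1 := pw Nb (Na + Nb) hN (n + 1) with hp1
  set lam : (Fin Nb → Fin (Na + Nb)) → ℝ := fun p => ∑ i, v (p i) - ∑ i, v (p0 i) with hlam
  set mu : (Fin Nb → Fin (Na + Nb)) → ℝ := fun p => ∑ i, v (p i) ^ 2 - ∑ i, v (p0 i) ^ 2 with hmu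
  set d := κ (n + Nb) - κ n with hd
  set d2 := κ (n + Nb) ^ 2 - κ n ^ 2 with hd2
  have vidx : ∀ m, v (idx (Na + Nb) hN m) = κ m := fun m => kidx _ hN κ hper' m
  have lam0 : lam p0 = 0 := by simp [hlam]
  have mu0 : mu p0 = 0 := by simp [hmu]
  have lam1 : lam p1 = d := by
    have := sum_pw Nb (Na + Nb) hN n v
    rw [vidx, vidx] at this
    exact this
  have mu1 : mu p1 = d2 := by
    have := sum_pw Nb (Na + Nb) hN n (fun k => v k ^ 2)
    simp only [vidx] at this
    exact this
  -- the normalized sums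
  set T : ℕ → ℝ → ℝ → ℝ := fun k a b =>
    ∑ p, cco Nb (Na + Nb) v D p * (lam p ^ k * Real.exp (lam p * a + mu p * b)) with hT
  set R : ℕ → ℝ → ℝ → ℝ := fun k a b => ∑ p ∈ restS Nb (Na + Nb) p0 p1,
    cco Nb (Na + Nb) v D p * (lam p ^ k * Real.exp (lam p * a + mu p * b)) with hR
  set A : ℕ → ℝ → ℝ → ℝ := fun k a b =>
    z0 * 0 ^ k + z1 * (d ^ k * Real.exp (d * a + d2 * b)) with hA
  have split : ∀ k a b, T k a b = A k a b + R k a b := by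
    intro k a b
    have := sum_split Nb (Na + Nb) v D p0 p1 (pw_inj _ _ _ (by omega) _)
      (pw_inj _ _ _ (by omega) _) (pw_ne Na Nb hNa hNb hN n)
      (fun p => lam p ^ k * Real.exp (lam p * a + mu p * b)) (by
        intro p σ
        have e1 : lam (p ∘ σ) = lam p := by
          simp only [hlam, Function.comp]
          rw [Equiv.sum_comp σ (fun i => v (p i))]
        have e2 : mu (p ∘ σ) = mu p := by
          simp only [hmu, Function.comp]
          rw [Equiv.sum_comp σ (fun i => v (p i) ^ 2)]
        simp only [e1, e2])
    simp only [hT, hA, hR]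
    rw [this, ← ez0, ← ez1, lam0, lam1, mu0, mu1]
    simp
  have tau : ∀ a b, tauf Na Nb κ D (a, b)
      = Real.exp ((∑ i, v (p0 i)) * a + (∑ i, v (p0 i) ^ 2) * b) * T 0 a b := by
    intro a b
    unfold tauf
    have := det_expand Nb (Na + Nb) v (fun k => Real.exp (v k * a + v k ^ 2 * b)) D
    refine Eq.trans this ?_
    simp only [hT]
    rw [Finset.mul_sum]
    refine Finset.sum_congr rfl fun p _ => ?_
    rw [← Real.exp_sum, pow_zero, one_mul, mul_left_comm, ← Real.exp_add]
    congr 2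
    simp only [hlam, hmu]
    rw [Finset.sum_add_distrib, ← Finset.sum_mul, ← Finset.sum_mul]
    ring
  have hexp : ∀ l m b a : ℝ, HasDerivAt (fun y => Real.exp (l * y + m * b))
      (Real.exp (l * a + m * b) * l) a := by
    intro l m b a
    have : HasDerivAt (fun y => l * y + m * b) l a := by
      simpa using ((hasDerivAt_id a).const_mul l).add_const (m * b)
    exact this.exp
  have dT : ∀ k b a, HasDerivAt (fun y => T k y b) (T (k + 1) a b) a := by
    intro k b a
    simp only [hT]
    apply HasDerivAt.fun_sum
    intro p _
    have := ((hexp (lam p) (mu p) b a).const_mul (lam p ^ k)).const_mul (cco Nb (Na + Nb) v D p)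
    refine this.congr_deriv ?_
    ring
  have dA : ∀ k b a, HasDerivAt (fun y => A k y b) (A (k + 1) a b) a := by
    intro k b a
    simp only [hA]
    have := (((hexp d d2 b a).const_mul (d ^ k)).const_mul z1).const_add (z0 * 0 ^ k)
    refine this.congr_deriv ?_
    rw [zero_pow (Nat.succ_ne_zero k)]
    ring
  have Apos : ∀ a b, z0 ≤ A 0 a b := by
    intro a b
    simp only [hA, pow_zero, mul_one, one_mul]
    have := Real.exp_pos (d * a + d2 * b)
    nlinarith [mul_pos hz1 this]
  have Abd : ∀ k a b, |A (k + 1) a b / A 0 a b| ≤ |d| ^ (k + 1) := by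
    intro k a b
    have h0 : 0 < A 0 a b := hz0.trans_le (Apos a b)
    rw [abs_div, abs_of_pos h0, div_le_iff₀ h0]
    have := Real.exp_pos (d * a + d2 * b)
    simp only [hA, pow_zero, mul_one, one_mul]
    rw [zero_pow (by omega), mul_zero, zero_add, abs_mul, abs_mul, abs_pow, abs_of_pos hz1,
      abs_of_pos this]
    have h3 : 0 ≤ |d| ^ (k + 1) := by positivity
    nlinarith [mul_nonneg h3 hz0.le]
  have Rlim : ∀ k, Tendsto (fun j => R k (x j).1 (x j).2) atTop (nhds 0) := by
    intro k
    simp only [hR]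
    rw [← Finset.sum_const_zero (s := restS Nb (Na + Nb) p0 p1)]
    apply tendsto_finsetSum
    intro p hp
    by_cases hc : cco Nb (Na + Nb) v D p = 0
    · simp [hc]
    have hinj := cco_inj _ _ _ _ _ hc
    have hlt := rest_lt Na Nb hNa hNb hN κ hper hmono n p hinj hp
      (fun k => -(d * (κ ((k : ℕ) + 1) - κ n) * (κ ((k : ℕ) + 1) - κ (n + Nb)))) (fun k => rfl)
    have hneg : lam p * (yv κ Nb n).1 + mu p * (yv κ Nb n).2 < 0 := by
      have key : ∀ q : Fin Nb → Fin (Na + Nb),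
          ∑ i, -(d * (κ (((q i : Fin (Na + Nb)) : ℕ) + 1) - κ n)
            * (κ (((q i : Fin (Na + Nb)) : ℕ) + 1) - κ (n + Nb)))
          = (∑ i, v (q i)) * (yv κ Nb n).1 + (∑ i, v (q i) ^ 2) * (yv κ Nb n).2
            - (Nb : ℝ) * (d * κ n * κ (n + Nb)) := by
        intro q
        rw [Finset.sum_mul, Finset.sum_mul, ← Finset.sum_add_distrib]
        have : (Nb : ℝ) * (d * κ n * κ (n + Nb)) = ∑ i : Fin Nb, d * κ n * κ (n + Nb) := by simp
        rw [this, ← Finset.sum_sub_distrib]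
        refine Finset.sum_congr rfl fun i _ => ?_
        simp only [hv, hd, yv]
        ring
      rw [key, key] at hlt
      simp only [hlam, hmu]
      linarith
    have := exp_lim κ Nb n x hx _ _ hneg
    have := (this.const_mul (lam p ^ k)).const_mul (cco Nb (Na + Nb) v D p)
    simpa using this
  -- second log derivatives
  have hev : ∀ᶠ j in atTop, T 0 (x j).1 (x j).2 ≠ 0 := by
    have := (Rlim 0).eventually (lt_mem_nhds (neg_lt_zero.2 hz0))
    filter_upwards [this] with j hj
    rw [split]
    have := Apos (x j).1 (x j).2
    linarith
  have L1 := ratio_lim (fun j => A 0 (x j).1 (x j).2) (fun j => R 0 (x j).1 (x j).2)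
    (fun j => A 1 (x j).1 (x j).2) (fun j => R 1 (x j).1 (x j).2) z0 _ hz0
    (fun j => Apos _ _) (fun j => Abd 0 _ _) (Rlim 0) (Rlim 1)
  have L2 := ratio_lim (fun j => A 0 (x j).1 (x j).2) (fun j => R 0 (x j).1 (x j).2)
    (fun j => A 2 (x j).1 (x j).2) (fun j => R 2 (x j).1 (x j).2) z0 _ hz0
    (fun j => Apos _ _) (fun j => Abd 1 _ _) (Rlim 0) (Rlim 2)
  have L3 := sq_lim _ _ _ (fun j => Abd 0 _ _) L1
  have L := (L2.sub L3).const_mul (-2)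
  simp only [sub_zero, mul_zero] at L
  refine L.congr' ?_
  filter_upwards [hev] with j hj
  have u := deriv2_log (fun y => tauf Na Nb κ D (y, (x j).2)) (fun y => T 0 y (x j).2)
    (fun y => T 1 y (x j).2) (fun y => T 2 y (x j).2) _ _ (x j).1 (fun y => tau y _)
    (dT 0 _) (dT 1 _) hj
  have w := deriv2_log (fun y => z0 + z1 * Real.exp (Kf κ (n + (Nb : ℤ)) (y, (x j).2)
      - Kf κ n (y, (x j).2))) (fun y => A 0 y (x j).2)
    (fun y => A 1 y (x j).2) (fun y => A 2 y (x j).2) 0 0 (x j).1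
    (by
      intro y
      simp only [hA, Kf, hd, hd2]
      rw [zero_mul, add_zero, Real.exp_zero, one_mul, pow_zero, pow_zero, mul_one, one_mul]
      congr 3
      ring)
    (dA 0 _) (dA 1 _) (hz0.trans_le (Apos _ _)).ne'
  rw [u, w, split, split, split]
  ring

/-- assume `f_{n_1,…,n_{N_b}} ≥ 0` for all `1 ≤ n_1 < ⋯ < n_{N_b} ≤ N`
and `z_n > 0` for `n = 1, …, N` (so `τ > 0` and the potential `u` is well defined).
Then for every integer `n` and every sequence `(x_j)` tending to infinity along the
ray `r_n`, the difference `u(x_j) − v_n(x_j)` converges to `0`, where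
`v_n(x) = −2 ∂²_{x₁} log ( z_n + z_{n+1} e^{K_{n+N_b}(x) − K_n(x)} )`. -/
theorem statement18 (Na Nb : ℕ) (hNa : 0 < Na) (hNb : 0 < Nb)
    (κ : ℤ → ℝ)
    (hper : ∀ k : ℤ, κ (k + (Na + Nb : ℤ)) = κ k)
    (hmono : ∀ k k' : ℤ, 1 ≤ k → k < k' → k' ≤ (Na + Nb : ℤ) → κ k < κ k')
    (D : Matrix (Fin (Na + Nb)) (Fin Nb) ℝ)
    (hreg : ∀ s : Fin Nb → Fin (Na + Nb), (∀ i j : Fin Nb, i < j → s i < s j) →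
      0 ≤ fcoef Na Nb (Nat.add_pos_left hNa Nb) κ D (fun i => (s i : ℤ) + 1))
    (hz : ∀ k : ℤ, 1 ≤ k → k ≤ (Na + Nb : ℤ) →
      0 < zc Na Nb (Nat.add_pos_left hNa Nb) κ D k)
    (n : ℤ) (x : ℕ → ℝ × ℝ) (hx : AlongRay κ Nb n x) :
    Filter.Tendsto
      (fun j => upot Na Nb κ D (x j) -
        vpot Na Nb (Nat.add_pos_left hNa Nb) κ D n (x j))
      atTop (nhds 0) := by
  have hN : 0 < Na + Nb := Nat.add_pos_left hNa Nb
  exact main_aux Na Nb hNa hNb hN κ hper hmono D hz n x hx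

end
end
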